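/- arXiv:2104.06741 — 2 statements merged into one kernel-verified Lean document; each statement's English description precedes it below -/
import Mathlib

section
/- Fix natural numbers n, m ≥ 1 and polynomials f_1,…,f_n, g_1,…,g_n ∈ ℤ[x_1,…,x_m]. Then the set of primes p for which the system f_1(x) = … = f_n(x) = 0, g_1(x) ≠ 0, …, g_n(x) ≠ 0 has a solution x ∈ (ℤ^ab/pℤ^ab)^m is either finite or contains all but finitely many primes. -/
noncomputable section

/-- The ring of abelian algebraic integers `ℤ^ab`: the subring of a fixed algebraic
closure of `ℚ` generated by all roots of unity. -/
noncomputable def Zab : Subring (AlgebraicClosure ℚ) :=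
  Subring.closure {x : AlgebraicClosure ℚ | ∃ n : ℕ, 0 < n ∧ x ^ n = 1}

/-- The quotient `ℤ^ab / p ℤ^ab`. -/
noncomputable abbrev ZabMod (p : ℕ) : Type :=
  Zab ⧸ Ideal.span {(p : Zab)}

section Helpers

/-- The subring generated by all roots of unity, in an abstract field. -/
def ZG (L : Type) [Field L] : Subring L :=
  Subring.closure {x : L | ∃ n : ℕ, 0 < n ∧ x ^ n = 1}

/-- Its quotient modulo `p`. -/
abbrev ZGM (L : Type) [Field L] (p : ℕ) : Type :=
  ZG L ⧸ Ideal.span {(p : ZG L)}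


set_option linter.unusedSectionVars false
variable {L : Type} [Field L] [CharZero L] [IsAlgClosed L] [Algebra.IsAlgebraic ℚ L]

open Polynomial in
lemma cyc_int {N : ℕ} (hN : 0 < N) {ζ : L} (hζ : IsPrimitiveRoot ζ N)
    {u : L} (hu : u ∈ IntermediateField.adjoin ℚ {ζ}) (hi : IsIntegral ℤ u) :
    u ∈ Algebra.adjoin ℤ {ζ} := by
  have : NeZero N := ⟨hN.ne'⟩
  have : IsCyclotomicExtension {N} ℚ (IntermediateField.adjoin ℚ {ζ}) :=
    hζ.intermediateField_adjoin_isCyclotomicExtension ℚ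
  let ζ' : IntermediateField.adjoin ℚ {ζ} := ⟨ζ, IntermediateField.mem_adjoin_simple_self ℚ ζ⟩
  have hζ' : IsPrimitiveRoot ζ' N := by
    refine IsPrimitiveRoot.of_map_of_injective (f := algebraMap (IntermediateField.adjoin ℚ {ζ}) (L)) ?_ (FaithfulSMul.algebraMap_injective _ _)
    exact hζ
  have := IsCyclotomicExtension.Rat.isIntegralClosure_adjoin_singleton hζ'
  have hi' : IsIntegral ℤ (⟨u, hu⟩ : IntermediateField.adjoin ℚ {ζ}) := by
    rw [← isIntegral_algebraMap_iff (B := L) (FaithfulSMul.algebraMap_injective _ _)]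
    exact hi
  obtain ⟨y, hy⟩ := this.isIntegral_iff.1 hi'
  have hy2 := y.2
  have h3 : (y : IntermediateField.adjoin ℚ {ζ}) = ⟨u, hu⟩ := hy
  rw [h3] at hy2
  have h4 := Subalgebra.mem_map (f := ((IntermediateField.adjoin ℚ {ζ}).val.restrictScalars ℤ)).2 ⟨_, hy2, rfl⟩
  rw [AlgHom.map_adjoin_singleton] at h4
  exact h4

lemma root_mem_ZG {ζ : L} {N : ℕ} (hN : 0 < N) (h : ζ ^ N = 1) : ζ ∈ (ZG L) :=
  Subring.subset_closure ⟨N, hN, h⟩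

lemma exists_prim (L : Type) [Field L] [CharZero L] [IsAlgClosed L] (N : ℕ) (hN : 0 < N) : ∃ ζ : L, IsPrimitiveRoot ζ N := by
  have : NeZero N := ⟨hN.ne'⟩
  have : NeZero (N : L) := ⟨by exact_mod_cast hN.ne'⟩
  exact HasEnoughRootsOfUnity.exists_primitiveRoot _ N

lemma adjoin_le_ZG {ζ : L} {N : ℕ} (hN : 0 < N) (h : ζ ^ N = 1)
    {c : L} (hc : c ∈ Algebra.adjoin ℤ {ζ}) : c ∈ (ZG L) := by
  have : Algebra.adjoin ℤ {ζ} ≤ subalgebraOfSubring (ZG L) := by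
    rw [Algebra.adjoin_le_iff]
    simpa using root_mem_ZG hN h
  exact this hc

lemma mem_ZG_level {c : L} (hc : c ∈ (ZG L)) :
    ∃ N : ℕ, 0 < N ∧ ∀ ζ : L, IsPrimitiveRoot ζ N → c ∈ Algebra.adjoin ℤ {ζ} := by
  have key : ∀ N₁ N₂ : ℕ, 0 < N₁ → 0 < N₂ → ∀ c : L,
      (∀ ζ : L, IsPrimitiveRoot ζ N₁ → c ∈ Algebra.adjoin ℤ {ζ}) →
      (∀ ζ : L, IsPrimitiveRoot ζ (N₁ * N₂) → c ∈ Algebra.adjoin ℤ {ζ}) := by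
    intro N₁ N₂ h1 h2 c h ζ hζ
    have := h (ζ ^ N₂) (hζ.pow (by positivity) (by ring))
    refine (Algebra.adjoin_le ?_) this
    simpa using pow_mem (Algebra.self_mem_adjoin_singleton ℤ ζ) N₂
  induction hc using Subring.closure_induction with
  | mem x hx =>
    obtain ⟨n, hn, hx⟩ := hx
    refine ⟨n, hn, fun ζ hζ => ?_⟩
    have : NeZero n := ⟨hn.ne'⟩
    obtain ⟨i, _, rfl⟩ := hζ.eq_pow_of_pow_eq_one hx
    exact pow_mem (Algebra.self_mem_adjoin_singleton ℤ ζ) i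
  | zero => exact ⟨1, one_pos, fun ζ _ => zero_mem _⟩
  | one => exact ⟨1, one_pos, fun ζ _ => one_mem _⟩
  | add x y _ _ hx hy =>
    obtain ⟨a, ha, hx⟩ := hx
    obtain ⟨b, hb, hy⟩ := hy
    refine ⟨a * b, by positivity, fun ζ hζ => add_mem (key a b ha hb x hx ζ hζ) (key b a hb ha y hy ζ (by rwa [mul_comm]))⟩
  | mul x y _ _ hx hy =>
    obtain ⟨a, ha, hx⟩ := hx
    obtain ⟨b, hb, hy⟩ := hy
    refine ⟨a * b, by positivity, fun ζ hζ => mul_mem (key a b ha hb x hx ζ hζ) (key b a hb ha y hy ζ (by rwa [mul_comm]))⟩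
  | neg x _ hx =>
    obtain ⟨a, ha, hx⟩ := hx
    exact ⟨a, ha, fun ζ hζ => neg_mem (hx ζ hζ)⟩

lemma mem_IF_of_adjoin {ζ c : L} (hc : c ∈ Algebra.adjoin ℤ {ζ}) :
    c ∈ IntermediateField.adjoin ℚ {ζ} := by
  have : Algebra.adjoin ℤ {ζ} ≤ (IntermediateField.adjoin ℚ {ζ}).toSubalgebra.restrictScalars ℤ := by
    rw [Algebra.adjoin_le_iff]
    simpa using IntermediateField.mem_adjoin_simple_self ℚ ζ
  exact this hc

lemma mem_IF_of_mul {ζ c u : L} {p : ℕ} (hp : p ≠ 0)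
    (hc : c ∈ Algebra.adjoin ℤ {ζ}) (h : p * u = c) :
    u ∈ IntermediateField.adjoin ℚ {ζ} := by
  have hp' : (p : L) ≠ 0 := by exact_mod_cast hp
  have : u = (p : L)⁻¹ * c := by rw [← h]; field_simp
  rw [this]
  exact mul_mem (inv_mem (natCast_mem _ p)) (mem_IF_of_adjoin hc)

/-- ZAB is integrally closed (the form we need). -/
lemma ZG_int {c u : L} {p : ℕ} (hp : p ≠ 0) (hc : c ∈ (ZG L)) (h : p * u = c)
    (hu : IsIntegral ℤ u) : u ∈ (ZG L) := by
  obtain ⟨N, hN, hc⟩ := mem_ZG_level hc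
  obtain ⟨ζ, hζ⟩ := exists_prim L N hN
  exact adjoin_le_ZG hN hζ.pow_eq_one (cyc_int hN hζ (mem_IF_of_mul hp (hc ζ hζ) h) hu)

lemma ZG_isIntegral {c : L} (hc : c ∈ (ZG L)) : IsIntegral ℤ c := by
  have : (ZG L) ≤ (integralClosure ℤ (L)).toSubring := by
    rw [ZG, Subring.closure_le]
    rintro x ⟨n, hn, hx⟩
    exact IsIntegral.of_pow hn (by rw [hx]; exact isIntegral_one)
  exact this hc

lemma ZGM_zero_iff {p : ℕ} (c : (ZG L)) : (Ideal.Quotient.mk (Ideal.span {(p : (ZG L))}) c = 0) ↔ ∃ u : (ZG L), (p : L) * u = c := by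
  rw [Ideal.Quotient.eq_zero_iff_mem, Ideal.mem_span_singleton]
  constructor
  · rintro ⟨u, rfl⟩
    exact ⟨u, by push_cast; rfl⟩
  · rintro ⟨u, hu⟩
    exact ⟨u, Subtype.ext (by push_cast; exact hu.symm)⟩

lemma ZGM_charP (L : Type) [Field L] [CharZero L] [IsAlgClosed L] [Algebra.IsAlgebraic ℚ L] (p : ℕ) [Fact p.Prime] : CharP (ZGM L p) p := by
  have h0 : ((p : ℕ) : ZGM L p) = 0 := by
    have : ((p : ℕ) : ZGM L p) = Ideal.Quotient.mk (Ideal.span {(p : (ZG L))}) (p : (ZG L)) := by simp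
    rw [this, Ideal.Quotient.eq_zero_iff_mem]
    exact Ideal.mem_span_singleton_self _
  have hp : p.Prime := Fact.out
  have : Nontrivial (ZGM L p) := by
    refine ⟨1, 0, fun h => ?_⟩
    have h' : Ideal.Quotient.mk (Ideal.span {(p : (ZG L))}) 1 = 0 := h
    rw [ZGM_zero_iff] at h'
    obtain ⟨u, hu⟩ := h'
    have hi := ZG_isIntegral u.2
    have hu' : (u : L) = algebraMap ℚ _ ((p : ℚ)⁻¹) := by
      have : (p : L) ≠ 0 := by exact_mod_cast hp.ne_zero
      rw [map_inv₀, map_natCast]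
      field_simp
      rw [mul_comm, hu]; simp
    rw [hu', isIntegral_algebraMap_iff (FaithfulSMul.algebraMap_injective _ _)] at hi
    obtain ⟨z, hz⟩ := IsIntegrallyClosed.isIntegral_iff.1 hi
    have hz' : (z : ℚ) = (p : ℚ)⁻¹ := by simpa using hz
    have hp0 : (p : ℚ) ≠ 0 := by exact_mod_cast hp.ne_zero
    have : (z * p : ℤ) = 1 := by
      have : ((z * p : ℤ) : ℚ) = 1 := by push_cast; rw [hz']; field_simp
      exact_mod_cast this
    have := Int.isUnit_iff.1 (IsUnit.of_mul_eq_one _ (by rw [mul_comm]; exact this))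
    have h2 := hp.two_le
    omega
  exact (CharP.charP_iff_prime_eq_zero hp).2 h0

open Polynomial in
lemma cyc_inj (L : Type) [Field L] [CharZero L] [IsAlgClosed L] [Algebra.IsAlgebraic ℚ L] (p : ℕ) [hp : Fact p.Prime] (M : ℕ) (hM : 0 < M) :
    ∃ φ : AdjoinRoot (cyclotomic M (ZMod p)) →+* ZGM L p, Function.Injective φ := by
  have := ZGM_charP L p
  let : Algebra (ZMod p) (ZGM L p) := ZMod.algebra _ p
  obtain ⟨ζ, hζ⟩ := exists_prim L M hM
  let z : (ZG L) := ⟨ζ, root_mem_ZG hM hζ.pow_eq_one⟩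
  let q := Ideal.Quotient.mk (Ideal.span {(p : (ZG L))})
  have hev : ∀ H : ℤ[X], eval₂ (algebraMap (ZMod p) (ZGM L p)) (q z) (H.map (Int.castRingHom (ZMod p))) = q (aeval z H) := by
    intro H
    rw [eval₂_map, aeval_def, hom_eval₂]
    congr 1
    exact RingHom.ext_int _ _
  have hval : ∀ H : ℤ[X], ((aeval z H : (ZG L)) : L) = aeval ζ H := by
    intro H
    rw [aeval_def, aeval_def, ← Subring.coe_subtype, hom_eval₂]
    congr 1
  have hmin : cyclotomic M ℤ = minpoly ℤ ζ := cyclotomic_eq_minpoly hζ hM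
  have h0 : eval₂ (algebraMap (ZMod p) (ZGM L p)) (q z) (cyclotomic M (ZMod p)) = 0 := by
    rw [← map_cyclotomic M (Int.castRingHom (ZMod p)), hev]
    have : aeval z (cyclotomic M ℤ) = 0 := by
      apply Subtype.ext
      rw [hval, hmin, minpoly.aeval]; rfl
    rw [this, map_zero]
  refine ⟨AdjoinRoot.lift _ (q z) h0, ?_⟩
  rw [injective_iff_map_eq_zero]
  intro a ha
  obtain ⟨h, rfl⟩ := AdjoinRoot.mk_surjective a
  rw [AdjoinRoot.lift_mk] at ha
  obtain ⟨H, rfl⟩ := Polynomial.map_surjective (Int.castRingHom (ZMod p)) (ZMod.ringHom_surjective _) h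
  rw [hev] at ha
  obtain ⟨u, hu⟩ := (ZGM_zero_iff _).1 ha
  rw [hval] at hu
  have hmem : aeval ζ H ∈ Algebra.adjoin ℤ {ζ} := aeval_mem_adjoin_singleton ℤ ζ
  have hu2 := cyc_int hM hζ (mem_IF_of_mul hp.out.ne_zero hmem hu) (ZG_isIntegral u.2)
  rw [Algebra.adjoin_singleton_eq_range_aeval] at hu2
  obtain ⟨d, hd⟩ := hu2
  have hd' : aeval ζ d = (u : L) := hd
  have hz : aeval ζ (H - C (p : ℤ) * d) = 0 := by
    rw [map_sub, map_mul, hd', aeval_C, ← hu]; simp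
  have hdvd := minpoly.isIntegrallyClosed_dvd (hζ.isIntegral hM) hz
  rw [← hmin] at hdvd
  have := Polynomial.map_dvd (Int.castRingHom (ZMod p)) hdvd
  rw [map_cyclotomic, Polynomial.map_sub, Polynomial.map_mul] at this
  simp only [map_C] at this
  rw [show (Int.castRingHom (ZMod p)) (p : ℤ) = 0 by simp] at this
  rw [AdjoinRoot.mk_eq_zero]
  simpa using this


open Polynomial in
lemma p_eq_pi_pow (L : Type) [Field L] [CharZero L] [IsAlgClosed L] [Algebra.IsAlgebraic ℚ L]
    (p : ℕ) [hp : Fact p.Prime] (k : ℕ) {ζ : L}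
    (hζ : IsPrimitiveRoot ζ (p ^ (k + 1))) :
    ∃ c ∈ ZG L, (ζ - 1) ^ (p ^ (k + 1)).totient * c = p := by
  have hpos : 0 < p ^ (k + 1) := pow_pos hp.out.pos _
  have : NeZero (p ^ (k+1)) := ⟨hpos.ne'⟩
  have h1 : eval 1 (cyclotomic (p ^ (k + 1)) L) = p := eval_one_cyclotomic_prime_pow k
  rw [cyclotomic_eq_prod_X_sub_primitiveRoots hζ, eval_prod] at h1
  have h2 : ∀ μ ∈ primitiveRoots (p ^ (k + 1)) L, ∃ s ∈ ZG L, eval 1 (X - C μ) = (ζ - 1) * s := by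
    intro μ hμ
    have hμ' := (mem_primitiveRoots hpos).1 hμ
    obtain ⟨i, _, rfl⟩ := hζ.eq_pow_of_pow_eq_one hμ'.pow_eq_one
    refine ⟨- ∑ j ∈ Finset.range i, ζ ^ j, neg_mem (sum_mem fun j _ => pow_mem (root_mem_ZG hpos hζ.pow_eq_one) j), ?_⟩
    have := mul_geom_sum ζ i
    simp only [eval_sub, eval_X, eval_C]
    rw [mul_neg, this]; ring
  choose! s hs1 hs2 using h2
  rw [Finset.prod_congr rfl hs2, Finset.prod_mul_distrib, Finset.prod_const,
    hζ.card_primitiveRoots] at h1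
  exact ⟨_, prod_mem hs1, h1⟩

open Polynomial in
lemma exists_pi (L : Type) [Field L] [CharZero L] [IsAlgClosed L] [Algebra.IsAlgebraic ℚ L]
    (p : ℕ) [hp : Fact p.Prime] (k : ℕ) :
    ∃ π : ZGM L p, π ^ (p ^ (k + 1)).totient = 0 ∧
      ∀ b : ZGM L p, b * π ^ ((p ^ (k + 1)).totient - 1) = 0 → IsNilpotent b := by
  have hpos : 0 < p ^ (k + 1) := pow_pos hp.out.pos _
  have := ZGM_charP L p
  obtain ⟨ζ, hζ⟩ := exists_prim L (p ^ (k + 1)) hpos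
  let z : ZG L := ⟨ζ, root_mem_ZG hpos hζ.pow_eq_one⟩
  let q := Ideal.Quotient.mk (Ideal.span {(p : ZG L)})
  have hH : 0 < (p ^ (k + 1)).totient := Nat.totient_pos.2 hpos
  have hpi : (q (z - 1)) ^ (p ^ (k + 1)).totient = 0 := by
    have h0 : eval z (cyclotomic (p ^ (k + 1)) (ZG L)) = 0 := by
      apply Subtype.ext
      have h := hζ.isRoot_cyclotomic hpos
      rw [IsRoot.def, ← map_cyclotomic _ (ZG L).subtype, show ζ = (ZG L).subtype z from rfl, eval_map, eval₂_hom] at h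
      exact h
    have h1 : eval (q z) (cyclotomic (p ^ (k + 1)) (ZGM L p)) = 0 := by
      rw [← map_cyclotomic _ q, eval_map, eval₂_hom, h0, map_zero]
    have h2 := cyclotomic_mul_prime_pow_eq (ZGM L p) (p := p) (m := 1) (k := k + 1) (by simpa using hp.out.one_lt.ne') (by omega)
    rw [mul_one] at h2
    rw [h2] at h1
    rw [Nat.totient_prime_pow_succ hp.out]
    have h3 : p ^ (k + 1) - p ^ (k + 1 - 1) = p ^ k * (p - 1) := by
      rw [Nat.mul_sub, pow_succ]; simp
    rw [h3] at h1
    simpa using h1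
  refine ⟨q (z - 1), hpi, fun b hb => ?_⟩
  obtain ⟨b, rfl⟩ := Ideal.Quotient.mk_surjective b
  refine ⟨(p ^ (k + 1)).totient, ?_⟩
  have hb' : q (b * (z - 1) ^ ((p ^ (k + 1)).totient - 1)) = 0 := by
    rw [map_mul, map_pow]; exact hb
  obtain ⟨u, hu⟩ := (ZGM_zero_iff _).1 hb'
  obtain ⟨c, hc, hcp⟩ := p_eq_pi_pow L p k hζ
  have hb2 : b = (z - 1) * (⟨c, hc⟩ * u) := by
    apply Subtype.ext
    have hp0 : (p : L) ≠ 0 := by exact_mod_cast hp.out.ne_zero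
    have hne : ζ - 1 ≠ 0 := by
      intro h
      rw [h, zero_pow hH.ne', zero_mul] at hcp
      exact hp0 hcp.symm
    have hne' : (ζ - 1) ^ ((p ^ (k + 1)).totient - 1) ≠ 0 := pow_ne_zero _ hne
    apply mul_right_cancel₀ hne'
    have e1 : ((b * (z - 1) ^ ((p ^ (k + 1)).totient - 1) : ZG L) : L) = b * (ζ - 1) ^ ((p ^ (k + 1)).totient - 1) := by
      push_cast; rfl
    rw [← e1, ← hu, ← hcp]
    push_cast
    rw [show (z : L) = ζ from rfl]
    obtain ⟨H, hH'⟩ : ∃ H, (p ^ (k + 1)).totient = H + 1 := ⟨_, (Nat.sub_add_cancel hH).symm⟩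
    rw [hH']
    simp only [Nat.add_sub_cancel]
    ring
  change q b ^ _ = 0
  rw [hb2, map_mul, mul_pow, hpi, zero_mul]

open Polynomial in
lemma eval_pi {A R : Type*} [CommRing A] [IsReduced A] [CommRing R] (θ : A →+* R)
    (hθ : Function.Injective θ) (π : R) (H : ℕ)
    (h0 : π ^ H = 0) (h1 : ∀ b : R, b * π ^ (H - 1) = 0 → IsNilpotent b) (h : A[X])
    (hh : eval₂ θ π h = 0) (e : ℕ) (he : e < H) : h.coeff e = 0 := by
  induction e using Nat.strong_induction_on with
  | _ e ih =>
    have hd : X ^ e ∣ h := X_pow_dvd_iff.2 fun d hd => ih d hd (hd.trans he)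
    obtain ⟨h', rfl⟩ := hd
    have hce : (X ^ e * h').coeff e = h'.coeff 0 := by simpa using coeff_X_pow_mul h' e 0
    rw [hce]
    rw [eval₂_mul, eval₂_X_pow] at hh
    have h3 : eval₂ θ π h' = θ (h'.coeff 0) + π * eval₂ θ π (divX h') := by
      conv_lhs => rw [← divX_mul_X_add h']
      rw [eval₂_add, eval₂_mul, eval₂_X, eval₂_C]; ring
    have h4 : θ (h'.coeff 0) * π ^ (H - 1) = 0 := by
      have e1 : π ^ (H - 1) = π ^ e * π ^ (H - 1 - e) := by rw [← pow_add]; congr 1; omega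
      have e2 : π ^ H = π ^ (H - 1) * π := by rw [← pow_succ]; congr 1; omega
      have : π ^ (H - 1 - e) * (π ^ e * eval₂ θ π h') = 0 := by rw [hh, mul_zero]
      rw [h3] at this
      have e3 : θ (h'.coeff 0) * π ^ (H - 1) = π ^ (H - 1 - e) * (π ^ e * (θ (h'.coeff 0) + π * eval₂ θ π (divX h'))) - π ^ H * eval₂ θ π (divX h') := by
        rw [e2, e1]; ring
      rw [e3, this, h0]; ring
    have h5 := h1 _ h4
    have h6 : IsNilpotent (h'.coeff 0) := by
      obtain ⟨n, hn⟩ := h5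
      exact ⟨n, hθ (by rw [map_pow, hn, map_zero])⟩
    exact h6.eq_zero


lemma totient_bound (n : ℕ) : n ≤ 2 * n.totient ^ 2 ∧ (Odd n → n ≤ n.totient ^ 2) := by
  induction n using Nat.recOnPosPrimePosCoprime with
  | zero => simp
  | one => simp
  | prime_pow p k hp hk =>
    obtain ⟨k, rfl⟩ : ∃ j, k = j + 1 := ⟨k - 1, by omega⟩
    rw [Nat.totient_prime_pow_succ hp]
    have h1 : 1 ≤ p ^ k := Nat.one_le_pow _ _ hp.pos
    rcases hp.eq_two_or_odd' with rfl | ho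
    · refine ⟨?_, fun h => ?_⟩
      · rw [pow_succ]; nlinarith
      · exfalso
        rw [Nat.odd_pow_iff (by omega)] at h
        exact absurd h (by decide)
    · have h3 : 3 ≤ p := by
        have := hp.two_le
        rcases this.eq_or_lt with h | h
        · subst h; exact absurd ho (by decide)
        · exact h
      have key : p ^ (k + 1) ≤ (p ^ k * (p - 1)) ^ 2 := by
        obtain ⟨r, rfl⟩ : ∃ r, p = r + 1 := ⟨p - 1, by omega⟩
        simp only [Nat.add_sub_cancel]
        rw [pow_succ, mul_pow]
        have : r + 1 ≤ r ^ 2 := by nlinarith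
        have h2 : (r+1)^k ≤ ((r+1)^k)^2 := by nlinarith
        exact Nat.mul_le_mul h2 this
      exact ⟨by omega, fun _ => key⟩
  | coprime a b ha hb hab iha ihb =>
    rw [Nat.totient_mul hab]
    have odd_or : Odd a ∨ Odd b := by
      by_contra h
      push Not at h
      have h1 := (Nat.not_odd_iff_even.1 h.1).two_dvd
      have h2 := (Nat.not_odd_iff_even.1 h.2).two_dvd
      have := Nat.dvd_gcd h1 h2
      rw [hab] at this
      omega
    refine ⟨?_, fun h => ?_⟩
    · rcases odd_or with h | h
      · calc a * b ≤ a.totient ^ 2 * (2 * b.totient ^ 2) := Nat.mul_le_mul (iha.2 h) ihb.1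
          _ = _ := by ring
      · calc a * b ≤ (2 * a.totient ^ 2) * (b.totient ^ 2) := Nat.mul_le_mul iha.1 (ihb.2 h)
          _ = _ := by ring
    · rw [Nat.odd_mul] at h
      calc a * b ≤ a.totient ^ 2 * (b.totient ^ 2) := Nat.mul_le_mul (iha.2 h.1) (ihb.2 h.2)
          _ = _ := by ring

lemma exists_s (p : ℕ) (hp : p.Prime) (n s₀ : ℕ) (hs : 0 < s₀) :
    ∃ s, s₀ ∣ s ∧ 0 < s ∧ n * s ≤ (p ^ s - 1).totient ∧ 1 < p ^ s - 1 := by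
  have h := tendsto_pow_const_div_const_pow_of_one_lt 2 (r := 2) (by norm_num)
  have hc : (0 : ℝ) < 1 / (2 * n ^ 2 + 2) := by positivity
  have h2 := (h.eventually_lt_const hc)
  obtain ⟨a, ha⟩ := Filter.eventually_atTop.1 h2
  let s := s₀ * (a + 1)
  have hsa : a + 1 ≤ s := Nat.le_mul_of_pos_left _ hs
  have hs1 := ha s (by omega)
  rw [div_lt_div_iff₀ (by positivity) (by positivity)] at hs1
  have hs2 : s ^ 2 * (2 * n ^ 2 + 2) < 1 * 2 ^ s := by exact_mod_cast hs1
  have hps : 2 ^ s ≤ p ^ s := Nat.pow_le_pow_left hp.two_le s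
  have hpos : 1 ≤ s := by omega
  have hsq : 1 ≤ s ^ 2 := Nat.one_le_pow _ _ hpos
  have hb := (totient_bound (p ^ s - 1)).1
  refine ⟨s, Dvd.intro _ rfl, by omega, ?_, ?_⟩
  · have h5 : 2 * (n * s) ^ 2 ≤ 2 * (p ^ s - 1).totient ^ 2 := by
      have : 2 * (n * s) ^ 2 + 1 ≤ p ^ s := by nlinarith
      omega
    exact (Nat.pow_le_pow_iff_left (n := 2) (by norm_num)).1 (by omega)
  · have : 3 ≤ p ^ s := by nlinarith [sq_nonneg (n : ℤ), Nat.zero_le (s^2 * n^2)]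
    omega

open Polynomial in
lemma exists_FF (p : ℕ) [hp : Fact p.Prime] (F : Type) [Field F] [Finite F] [CharP F p] (n : ℕ) (hn : 1 ≤ n) :
    ∃ M : ℕ, 0 < M ∧ ∃ θ : (Fin n → F) →+* AdjoinRoot (cyclotomic M (ZMod p)),
      Function.Injective θ := by
  let _ : Algebra (ZMod p) F := ZMod.algebra F p
  have : Module.Finite (ZMod p) F := Module.Finite.of_finite
  obtain ⟨s, hs0, hs, hns, hM1⟩ := exists_s p hp.out n (Module.finrank (ZMod p) F) Module.finrank_pos
  set M := p ^ s - 1 with hM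
  have hMp : 0 < M := by omega
  have hq : M + 1 = p ^ s := by have := Nat.pow_pos (n := s) hp.out.pos; omega
  refine ⟨M, hMp, ?_⟩
  set B := AdjoinRoot (cyclotomic M (ZMod p)) with hB
  have hmonic : (cyclotomic M (ZMod p)).Monic := cyclotomic.monic M _
  let pb := AdjoinRoot.powerBasis' hmonic
  have hcard : Nat.card B = p ^ M.totient := by
    have : Module.Finite (ZMod p) B := pb.finite
    rw [Module.natCard_eq_pow_finrank (K := ZMod p), pb.finrank, Nat.card_zmod]
    simp [pb, natDegree_cyclotomic]
  have hfin : Finite B := Nat.finite_of_card_ne_zero (by rw [hcard]; exact pow_ne_zero _ hp.out.ne_zero)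
  have htp : 0 < M.totient := Nat.totient_pos.2 hMp
  have hnt : Nontrivial B := by
    rw [← Finite.one_lt_card_iff_nontrivial, hcard]
    exact Nat.one_lt_pow htp.ne' hp.out.one_lt
  have hch : CharP B p := charP_of_injective_algebraMap (algebraMap (ZMod p) B).injective p
  have hroot : (AdjoinRoot.root (cyclotomic M (ZMod p))) ^ M = 1 := by
    have h1 : aeval (AdjoinRoot.root (cyclotomic M (ZMod p))) (cyclotomic M (ZMod p)) = 0 := by
          rw [aeval_def]; exact AdjoinRoot.eval₂_root _
    have h2 := aeval_eq_zero_of_dvd_aeval_eq_zero (cyclotomic.dvd_X_pow_sub_one M (ZMod p)) h1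
    simpa [sub_eq_zero] using h2
  have hfrob : ∀ b : B, b ^ p ^ s = b := by
    intro b
    have : (iterateFrobenius B p s).comp (AdjoinRoot.mk (cyclotomic M (ZMod p))) = AdjoinRoot.mk (cyclotomic M (ZMod p)) := by
      apply Polynomial.ringHom_ext'
      · exact RingHom.ext_zmod _ _
      · simp only [RingHom.comp_apply, iterateFrobenius_def]
        have hroot' : (AdjoinRoot.mk (cyclotomic M (ZMod p)) X) ^ M = 1 := hroot
        rw [← hq, pow_succ, hroot', one_mul]
    obtain ⟨f, rfl⟩ := AdjoinRoot.mk_surjective b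
    exact DFunLike.congr_fun this f
  have hred : IsReduced B := by
    refine ⟨fun b hb => ?_⟩
    obtain ⟨k, hk⟩ := hb
    have h1 : ∀ j, b ^ (p ^ s) ^ j = b := by
      intro j
      induction j with
      | zero => simp
      | succ j ih => rw [pow_succ, pow_mul, ih, hfrob]
    have h2 : k ≤ (p ^ s) ^ k := (Nat.lt_pow_self (by omega)).le
    rw [← h1 k]
    exact pow_eq_zero_of_le h2 hk
  have hmax : ∀ I : MaximalSpectrum B, Nat.card (B ⧸ I.asIdeal) = p ^ s := by
    intro I
    have : I.asIdeal.IsMaximal := I.isMaximal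
    let _ : Field (B ⧸ I.asIdeal) := Ideal.Quotient.field _
    have : CharP (B ⧸ I.asIdeal) p := charP_of_injective_algebraMap (algebraMap (ZMod p) (B ⧸ I.asIdeal)).injective p
    have : Finite (B ⧸ I.asIdeal) := Finite.of_surjective _ Ideal.Quotient.mk_surjective
    have : Fintype (B ⧸ I.asIdeal) := Fintype.ofFinite _
    apply le_antisymm
    · let P : (B ⧸ I.asIdeal)[X] := X ^ (p ^ s) - X
      have hPd : P.natDegree = p ^ s := FiniteField.X_pow_card_sub_X_natDegree_eq _ (by omega)
      have hP0 : P ≠ 0 := FiniteField.X_pow_card_sub_X_ne_zero _ (by omega)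
      have : (Finset.univ : Finset (B ⧸ I.asIdeal)).val ≤ P.roots := by
        rw [Multiset.le_iff_subset Finset.univ.nodup]
        intro x _
        rw [mem_roots hP0]
        obtain ⟨b, rfl⟩ := Ideal.Quotient.mk_surjective x
        simp [P, ← map_pow, hfrob]
      have h2 := Multiset.card_le_card this
      rw [Nat.card_eq_fintype_card, ← hPd]
      exact h2.trans (card_roots' P)
    · have hMne : NeZero (M : B ⧸ I.asIdeal) := by
        refine ⟨fun h => ?_⟩
        have : ((M + 1 : ℕ) : B ⧸ I.asIdeal) = 1 := by push_cast; rw [h, zero_add]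
        rw [hq, Nat.cast_pow, CharP.cast_eq_zero, zero_pow hs.ne'] at this
        exact zero_ne_one this
      have hr : IsRoot (cyclotomic M (B ⧸ I.asIdeal)) (Ideal.Quotient.mk I.asIdeal (AdjoinRoot.root (cyclotomic M (ZMod p)))) := by
        have h1 : aeval (AdjoinRoot.root (cyclotomic M (ZMod p))) (cyclotomic M (ZMod p)) = 0 := by
          rw [aeval_def]; exact AdjoinRoot.eval₂_root _
        rw [IsRoot.def, ← map_cyclotomic M ((Ideal.Quotient.mk I.asIdeal).comp (algebraMap (ZMod p) B)), eval_map, ← hom_eval₂]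
        rw [aeval_def] at h1
        rw [h1, map_zero]
      rw [isRoot_cyclotomic_iff] at hr
      have hz : (Ideal.Quotient.mk I.asIdeal (AdjoinRoot.root (cyclotomic M (ZMod p)))) ≠ 0 := hr.ne_zero hMp.ne'
      have hu := hr.isUnit_unit hMp.ne' 
      have ho := hu.eq_orderOf
      have h5 := orderOf_le_card (x := (hr.isUnit hMp.ne').unit)
      have : Fintype (B ⧸ I.asIdeal)ˣ := Fintype.ofFinite _
      rw [← ho, Nat.card_units, Nat.card_eq_fintype_card] at h5
      rw [Nat.card_eq_fintype_card]
      omega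
  have hcount : n ≤ Nat.card (MaximalSpectrum B) := by
    have e := Nat.card_congr (IsArtinianRing.equivPi B).toEquiv
    have : Fintype (MaximalSpectrum B) := Fintype.ofFinite _
    rw [Nat.card_pi, Finset.prod_congr rfl (fun I _ => hmax I), Finset.prod_const, hcard, ← pow_mul] at e
    have e2 := Nat.pow_right_injective hp.out.two_le e
    rw [Nat.card_eq_fintype_card]
    simp only [Finset.card_univ] at e2
    rw [e2, mul_comm] at hns
    exact Nat.le_of_mul_le_mul_left hns hs
  have hemb : ∀ I : MaximalSpectrum B, Nonempty (F →+* B ⧸ I.asIdeal) := by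
    intro I
    have : I.asIdeal.IsMaximal := I.isMaximal
    let _ : Field (B ⧸ I.asIdeal) := Ideal.Quotient.field _
    have hc := hmax I
    have : Finite (B ⧸ I.asIdeal) := Finite.of_surjective _ Ideal.Quotient.mk_surjective
    rw [Module.natCard_eq_pow_finrank (K := ZMod p), Nat.card_zmod] at hc
    have hc2 := Nat.pow_right_injective hp.out.two_le hc
    have hdv : Module.finrank (ZMod p) F ∣ Module.finrank (ZMod p) (B ⧸ I.asIdeal) := by
      rw [hc2]; exact hs0
    obtain ⟨φ⟩ := FiniteField.nonempty_algHom_of_finrank_dvd hdv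
    exact ⟨φ.toRingHom⟩
  have hsurj : ∃ i : MaximalSpectrum B → Fin n, Function.Surjective i := by
    have : Nonempty (Fin n) := ⟨⟨0, hn⟩⟩
    have : Fintype (MaximalSpectrum B) := Fintype.ofFinite _
    have h1 : Fintype.card (Fin n) ≤ Fintype.card (MaximalSpectrum B) := by
      rw [Fintype.card_fin, ← Nat.card_eq_fintype_card]; exact hcount
    obtain ⟨e⟩ := Function.Embedding.nonempty_of_card_le h1
    exact ⟨Function.invFun e, Function.invFun_surjective e.injective⟩
  obtain ⟨i, hi⟩ := hsurj
  let φ := fun I => (hemb I).some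
  let ψ : (Fin n → F) →+* (∀ I : MaximalSpectrum B, B ⧸ I.asIdeal) :=
    RingHom.pi fun I => (φ I).comp (Pi.evalRingHom _ (i I))
  refine ⟨((IsArtinianRing.equivPi B).symm.toRingEquiv.toRingHom).comp ψ, ?_⟩
  rw [RingHom.coe_comp]
  refine Function.Injective.comp (IsArtinianRing.equivPi B).symm.injective ?_
  intro a b hab
  funext j
  obtain ⟨I, rfl⟩ := hi j
  have h := congr_fun hab I
  have : I.asIdeal.IsMaximal := I.isMaximal
  have : Nontrivial (B ⧸ I.asIdeal) := Ideal.Quotient.nontrivial_iff.2 this.ne_top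
  exact (φ I).injective h


lemma ringHom_aeval {A B σ : Type*} [CommRing A] [CommRing B] [Algebra ℤ A] [Algebra ℤ B] (φ : A →+* B)
    (x : σ → A) (h : MvPolynomial σ ℤ) :
    φ (MvPolynomial.aeval x h) = MvPolynomial.aeval (fun j => φ (x j)) h := by
  rw [MvPolynomial.aeval_def, MvPolynomial.aeval_def, MvPolynomial.eval₂_comp_left]
  exact congrArg (fun t => MvPolynomial.eval₂ t _ h) (RingHom.ext_int _ _)

lemma exists_V (L : Type) [Field L] [CharZero L] [IsAlgClosed L] [Algebra.IsAlgebraic ℚ L]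
    (p : ℕ) [hp : Fact p.Prime] : ∃ V : ValuationSubring L, V.valuation (p : L) < 1 := by
  have hch := ZGM_charP L p
  have hnt : Nontrivial (ZGM L p) := CharP.nontrivial_of_char_ne_one (v := p) hp.out.one_lt.ne'
  have hI : Ideal.span {(p : ZG L)} ≠ ⊤ := Ideal.Quotient.nontrivial_iff.1 hnt
  obtain ⟨V, _, hV⟩ := Ideal.image_subset_nonunits_valuationSubring _ hI
  refine ⟨V, ?_⟩
  have : (p : L) ∈ V.nonunits := hV ⟨(p : ZG L), Ideal.mem_span_singleton_self _, by simp⟩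
  exact this

lemma int_mem_V {L : Type} [Field L] (V : ValuationSubring L) {a : L} (ha : IsIntegral ℤ a) : a ∈ V := by
  have h1 : IsIntegral V a := by
    obtain ⟨P, hP, hPa⟩ := ha
    refine ⟨P.map (Int.castRingHom V), hP.map _, ?_⟩
    rw [Polynomial.eval₂_map]
    rw [← hPa]
    exact congrArg (fun t => Polynomial.eval₂ t a P) (RingHom.ext_int _ _)
  obtain ⟨y, hy⟩ := IsIntegrallyClosed.isIntegral_iff.1 h1
  rw [← hy]; exact y.2

lemma V_all_but (L : Type) [Field L] [CharZero L] [IsAlgClosed L] [Algebra.IsAlgebraic ℚ L]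
    (a : L) : ∃ D : ℕ, D ≠ 0 ∧ ∀ p : ℕ, p.Prime → ¬ p ∣ D → ∀ V : ValuationSubring L,
      V.valuation (p : L) < 1 → a ∈ V := by
  have h1 : IsAlgebraic ℤ a := (IsFractionRing.isAlgebraic_iff ℤ ℚ L).2 (Algebra.IsAlgebraic.isAlgebraic a)
  obtain ⟨y, hy0, hy⟩ := h1.exists_integral_multiple
  refine ⟨y.natAbs, by simpa using hy0, fun p hp hpy V hV => ?_⟩
  have h2 : y • a ∈ V := int_mem_V V hy
  have hcop : IsCoprime y (p : ℤ) := by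
    rw [Int.isCoprime_iff_nat_coprime]
    simpa using ((Nat.Prime.coprime_iff_not_dvd hp).2 hpy).symm
  obtain ⟨r, s, hrs⟩ := hcop
  have hvint : ∀ z : ℤ, V.valuation (z : L) ≤ 1 := fun z => (V.valuation_le_one_iff _).2 (intCast_mem V z)
  have hvy : V.valuation (y : L) = 1 := by
    apply le_antisymm (hvint y)
    by_contra hlt
    push Not at hlt
    have : V.valuation ((r : L) * y + s * p) < 1 := by
      apply Valuation.map_add_lt
      · rw [map_mul]
        exact mul_lt_one_of_nonneg_of_lt_one_right (hvint r) zero_le hlt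
      · rw [map_mul]
        exact mul_lt_one_of_nonneg_of_lt_one_right (hvint s) zero_le hV
    rw [show (r : L) * y + s * p = 1 by exact_mod_cast congrArg (Int.cast : ℤ → L) hrs, map_one] at this
    exact lt_irrefl _ this
  rw [← V.valuation_le_one_iff] at h2 ⊢
  rw [zsmul_eq_mul, map_mul, hvy, one_mul] at h2
  exact h2

lemma V_all_but_finset (L : Type) [Field L] [CharZero L] [IsAlgClosed L] [Algebra.IsAlgebraic ℚ L]
    (S : Finset L) : ∃ D : ℕ, D ≠ 0 ∧ ∀ p : ℕ, p.Prime → ¬ p ∣ D → ∀ V : ValuationSubring L,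
      V.valuation (p : L) < 1 → ∀ a ∈ S, a ∈ V := by
  choose D hD0 hD using V_all_but L
  refine ⟨∏ a ∈ S, D a, Finset.prod_ne_zero_iff.2 fun a _ => hD0 a, fun p hp hpD V hV a ha => ?_⟩
  exact hD a p hp (fun h => hpD (h.trans (Finset.dvd_prod_of_mem D ha))) V hV

open MvPolynomial in
lemma fin_case (L : Type) [Field L] [CharZero L] [IsAlgClosed L] [Algebra.IsAlgebraic ℚ L]
    {n m : ℕ} (f : Fin n → MvPolynomial (Fin m) ℤ) (g : MvPolynomial (Fin m) ℤ)
    (q : Fin n → MvPolynomial (Fin m ⊕ Fin n) L)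
    (hq : ∀ x : Fin m → L, aeval x g ≠ 0 →
      ∑ i, (aeval x (f i) / aeval x g) * eval (Sum.elim x (fun j => aeval x (f j) / aeval x g)) (q i) = 1) :
    ∃ D : ℕ, D ≠ 0 ∧ ∀ p : ℕ, p.Prime → ¬ p ∣ D → ∀ x : Fin m → ZGM L p,
      (∀ i, aeval x (f i) = 0) → aeval x g = 0 := by
  classical
  obtain ⟨D, hD0, hD⟩ := V_all_but_finset L (Finset.univ.biUnion fun i => (q i).support.image fun d => (q i).coeff d)
  refine ⟨D, hD0, fun p hp hpD x hx => ?_⟩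
  choose X hX using fun j => Ideal.Quotient.mk_surjective (x j)
  obtain rfl : (fun j => Ideal.Quotient.mk _ (X j)) = x := funext hX
  have hmk : ∀ h : MvPolynomial (Fin m) ℤ, aeval (fun j => (Ideal.Quotient.mk (Ideal.span {(p : ZG L)}) (X j))) h = Ideal.Quotient.mk (Ideal.span {(p : ZG L)}) (aeval X h) := by
    intro h
    exact (ringHom_aeval (Ideal.Quotient.mk (Ideal.span {(p : ZG L)})) X h).symm
  have hval : ∀ h : MvPolynomial (Fin m) ℤ, ((aeval X h : ZG L) : L) = aeval (fun j => (X j : L)) h := by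
    intro h
    exact ringHom_aeval (ZG L).subtype X h
  by_contra hg
  rw [hmk, ZGM_zero_iff] at hg
  have hp0 : (p : L) ≠ 0 := by exact_mod_cast hp.ne_zero
  have hgne : aeval (fun j => (X j : L)) g ≠ 0 := by
    intro h
    exact hg ⟨0, by rw [hval, h]; simp⟩
  have hf : ∀ i, ∃ u : ZG L, (p : L) * u = aeval (fun j => (X j : L)) (f i) := by
    intro i
    have := hx i
    rw [hmk, ZGM_zero_iff] at this
    simpa [hval] using this
  choose v hv using hf
  have hq1 := hq _ hgne
  set u : L := aeval (fun j => (X j : L)) g / p with hu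
  have hpu : (p : L) * u = aeval (fun j => (X j : L)) g := by rw [hu]; field_simp
  have hnint : ¬ IsIntegral ℤ u := by
    intro h
    have := ZG_int hp.ne_zero (aeval X g).2 (by rw [hpu, hval]) h
    exact hg ⟨⟨u, this⟩, by rw [hval, ← hpu]⟩
  have hcl : IsIntegrallyClosedIn (integralClosure ℤ L).toSubring L :=
    inferInstanceAs (IsIntegrallyClosedIn (integralClosure ℤ L) L)
  obtain ⟨V, hRV, huV⟩ := Subring.exists_le_valuationSubring_of_isIntegrallyClosedIn (R := (integralClosure ℤ L).toSubring) (x := u) hnint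
  have hZV : ∀ z : ZG L, (z : L) ∈ V := fun z => int_mem_V V (ZG_isIntegral z.2)
  have hpV : V.valuation (p : L) < 1 := by
    apply lt_of_le_of_ne ((V.valuation_le_one_iff _).2 (natCast_mem V p))
    intro h
    apply huV
    have h2 := hZV (aeval X g)
    rw [hval, ← hpu] at h2
    rw [← V.valuation_le_one_iff] at h2 ⊢
    rwa [map_mul, h, one_mul] at h2
  have hqV := hD p hp hpD V hpV
  have huV' : 1 < V.valuation u := by
    rw [← V.valuation_le_one_iff] at huV
    exact not_le.1 huV
  have hu0 : u ≠ 0 := by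
    intro h; rw [h] at huV'; simp at huV'
  have hw : ∀ i, V.valuation (aeval (fun j => (X j : L)) (f i) / aeval (fun j => (X j : L)) g) < 1 := by
    intro i
    have : aeval (fun j => (X j : L)) (f i) / aeval (fun j => (X j : L)) g = v i / u := by
      rw [← hv, ← hpu]; field_simp
    rw [this, map_div₀]
    refine (div_lt_one₀ (zero_lt_one.trans huV')).2 (lt_of_le_of_lt ((V.valuation_le_one_iff _).2 (hZV (v i))) huV')
  have hlt : V.valuation (∑ i, (aeval (fun j => (X j : L)) (f i) / aeval (fun j => (X j : L)) g) * eval (Sum.elim (fun j => (X j : L)) (fun j => aeval (fun j => (X j : L)) (f j) / aeval (fun j => (X j : L)) g)) (q i)) < 1 := by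
    apply Valuation.map_sum_lt _ one_ne_zero
    intro i _
    have hm : eval (Sum.elim (fun j => (X j : L)) (fun j => aeval (fun j => (X j : L)) (f j) / aeval (fun j => (X j : L)) g)) (q i) ∈ V := by
      apply MvPolynomial.eval_mem
      · intro d hd
        refine hqV _ (Finset.mem_biUnion.2 ⟨i, Finset.mem_univ _, Finset.mem_image_of_mem _ hd⟩)
      · rintro (j | j)
        · exact hZV _
        · exact (V.valuation_le_one_iff _).1 (hw j).le
    rw [← V.valuation_le_one_iff] at hm
    rw [map_mul]
    exact mul_lt_one_of_nonneg_of_lt_one_left zero_le (hw i) hm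
  rw [hq1, map_one] at hlt
  exact lt_irrefl _ hlt


theorem loc_res {R D : Type} [CommRing R] [CommRing D] [Algebra R D] (M : Ideal R) [M.IsPrime]
    [IsLocalization.AtPrime D M] [IsLocalRing D] (r : R) (s : M.primeCompl) (a : R)
    (key : r - s * a ∈ M) :
    IsLocalization.mk' D r s - algebraMap R D a ∈ IsLocalRing.maximalIdeal D := by
  have key2 := (IsLocalization.AtPrime.to_map_mem_maximal_iff D M _).2 key
  have hu : IsUnit (algebraMap R D s) := IsLocalization.map_units D s
  have : algebraMap R D s * (IsLocalization.mk' D r s - algebraMap R D a) =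
      algebraMap R D (r - s * a) := by
    rw [mul_sub, IsLocalization.mk'_spec', map_sub, map_mul]
  rw [← this] at key2
  exact (Ideal.unit_mul_mem_iff_mem _ hu).1 key2

open Polynomial in
theorem curve_dim1 {K B : Type} [Field K] [IsAlgClosed K] [CharZero K] [CommRing B] [IsDomain B]
    [Algebra K[X] B] [Module.Finite K[X] B] (hinj : Function.Injective (algebraMap K[X] B))
    (m : Ideal B) [m.IsMaximal] (hm : algebraMap K[X] B X ∈ m) :
    ∃ (D : Type) (_ : CommRing D) (_ : IsDomain D) (_ : IsDiscreteValuationRing D) (φ : B →+* D),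
      Function.Injective φ ∧ (∀ b ∈ m, φ b ∈ IsLocalRing.maximalIdeal D) ∧
      ∀ d : D, ∃ k : K, d - φ (algebraMap K[X] B (C k)) ∈ IsLocalRing.maximalIdeal D := by
  classical
  let E := FractionRing B
  have : FaithfulSMul K[X] B := (faithfulSMul_iff_algebraMap_injective _ _).2 hinj
  have : FaithfulSMul K[X] E := by
    rw [faithfulSMul_iff_algebraMap_injective, IsScalarTower.algebraMap_eq K[X] B E]
    exact (IsFractionRing.injective B E).comp hinj
  let F := FractionRing K[X]
  let : Algebra F E := FractionRing.liftAlgebra K[X] E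
  have : IsScalarTower K[X] F E := inferInstance
  have : CharZero F := by
    have : CharZero K[X] := charZero_of_injective_algebraMap (R := K) (A := K[X]) Polynomial.C_injective
    exact charZero_of_injective_algebraMap (IsFractionRing.injective K[X] F)
  have : FiniteDimensional F E := inferInstance
  let R := integralClosure K[X] E
  have : IsDedekindDomain R := inferInstance
  have hbint : ∀ b : B, IsIntegral K[X] (algebraMap B E b) := fun b =>
    (Algebra.IsIntegral.isIntegral (R := K[X]) b).map (IsScalarTower.toAlgHom K[X] B E)
  let ψ : B →ₐ[K[X]] R := (IsScalarTower.toAlgHom K[X] B E).codRestrict R hbint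
  have hψ : Function.Injective ψ := fun a b h =>
    IsFractionRing.injective B E (congrArg Subtype.val h)
  let : Algebra B R := ψ.toRingHom.toAlgebra
  have : IsScalarTower K[X] B R := IsScalarTower.of_algebraMap_eq (fun x => (ψ.commutes x).symm)
  have : Algebra.IsIntegral K[X] R := inferInstance
  have : Algebra.IsIntegral B R := Algebra.IsIntegral.tower_top (R := K[X])
  have : FaithfulSMul B R := (faithfulSMul_iff_algebraMap_injective _ _).2 hψ
  obtain ⟨M, hM, hMo⟩ := Ideal.exists_ideal_over_maximal_of_isIntegral (S := R) m (by
    have : RingHom.ker (algebraMap B R) = ⊥ := (RingHom.injective_iff_ker_eq_bot _).1 hψ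
    rw [this]; exact bot_le)
  have hMm : ∀ b ∈ m, ψ b ∈ M := fun b hb => by
    rw [← hMo] at hb; exact hb
  have hM0 : M ≠ ⊥ := by
    intro h
    have := hMm _ hm
    rw [h, Ideal.mem_bot, map_eq_zero_iff _ hψ, map_eq_zero_iff _ hinj] at this
    exact X_ne_zero this
  let D := Localization.AtPrime M
  have : IsDomain D := inferInstance
  have : IsDiscreteValuationRing D :=
    IsLocalization.AtPrime.isDiscreteValuationRing_of_dedekind_domain R hM0 D
  have hres : ∀ r : R, ∃ k : K, r - algebraMap K[X] R (C k) ∈ M := by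
    let : Field (R ⧸ M) := Ideal.Quotient.field M
    let ι : K →+* R ⧸ M := (Ideal.Quotient.mk M).comp ((algebraMap K[X] R).comp C)
    have hcomp : ι.comp (evalRingHom 0) = (Ideal.Quotient.mk M).comp (algebraMap K[X] R) := by
      apply Polynomial.ringHom_ext
      · intro a; simp [ι]
      · have h1 : (algebraMap K[X] R) X ∈ M := by
          have := hMm _ hm
          rwa [ψ.commutes] at this
        simp only [RingHom.comp_apply, coe_evalRingHom, eval_X, map_zero]
        exact (Ideal.Quotient.eq_zero_iff_mem.2 h1).symm
    have hi : ι.IsIntegral := by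
      apply RingHom.IsIntegral.tower_top (evalRingHom 0) ι
      rw [hcomp]
      apply RingHom.IsIntegral.trans
      · exact Algebra.IsIntegral.isIntegral
      · exact RingHom.isIntegral_of_surjective _ Ideal.Quotient.mk_surjective
    let : Algebra K (R ⧸ M) := ι.toAlgebra
    have : Algebra.IsIntegral K (R ⧸ M) := ⟨hi⟩
    intro r
    obtain ⟨k, hk⟩ := (IsAlgClosed.algebraMap_bijective_of_isIntegral (k := K) (K := R ⧸ M)).2
      (Ideal.Quotient.mk M r)
    exact ⟨k, Ideal.Quotient.eq.1 hk.symm⟩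
  refine ⟨D, inferInstance, inferInstance, inferInstance, (algebraMap R D).comp ψ.toRingHom, ?_, ?_, ?_⟩
  · exact (IsLocalization.injective D M.primeCompl_le_nonZeroDivisors).comp hψ
  · intro b hb
    exact (IsLocalization.AtPrime.to_map_mem_maximal_iff D M _).2 (hMm b hb)
  · intro d
    obtain ⟨r, s, rfl⟩ := IsLocalization.exists_mk'_eq M.primeCompl d
    obtain ⟨k, hk⟩ := hres r
    obtain ⟨l, hl⟩ := hres s
    have hl0 : l ≠ 0 := by
      rintro rfl
      simp at hl
      exact s.2 hl
    refine ⟨k / l, ?_⟩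
    have hψC : ∀ a : K, ψ.toRingHom (algebraMap K[X] B (C a)) = algebraMap K[X] R (C a) :=
      fun a => ψ.commutes _
    rw [RingHom.comp_apply, hψC]
    have key : (r : R) - s * algebraMap K[X] R (C (k / l)) ∈ M := by
      have h1 : (r : R) - s * algebraMap K[X] R (C (k / l)) =
        (r - algebraMap K[X] R (C k)) - (s - algebraMap K[X] R (C l)) * algebraMap K[X] R (C (k/l)) := by
        have : algebraMap K[X] R (C k) = algebraMap K[X] R (C l) * algebraMap K[X] R (C (k/l)) := by
          rw [← map_mul, ← map_mul, mul_div_cancel₀ _ hl0]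
        rw [this]; ring
      rw [h1]
      exact M.sub_mem hk (M.mul_mem_right _ hl)
    exact loc_res M r s _ key


open Polynomial in
theorem curve {K S : Type} [Field K] [IsAlgClosed K] [CharZero K] [CommRing S] [IsDomain S]
    [Algebra K S] [Algebra.FiniteType K S] (m : Ideal S) [hm : m.IsMaximal] (s : S) (hs : s ≠ 0)
    (hsm : s ∈ m) :
    ∃ (D : Type) (_ : CommRing D) (_ : IsDomain D) (_ : IsDiscreteValuationRing D) (φ : S →+* D),
      φ s ≠ 0 ∧ (∀ b ∈ m, φ b ∈ IsLocalRing.maximalIdeal D) ∧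
      ∀ d : D, ∃ k : K, d - φ (algebraMap K S k) ∈ IsLocalRing.maximalIdeal D := by
  classical
  obtain ⟨r, ν, hν, hνf⟩ := exists_finite_inj_algHom_of_fg K S
  let R := MvPolynomial (Fin r) K
  let _ : Algebra R S := ν.toRingHom.toAlgebra
  have : IsScalarTower K R S := IsScalarTower.of_algebraMap_eq (fun x => (ν.commutes x).symm)
  have : Module.Finite R S := hνf
  have : FaithfulSMul R S := (faithfulSMul_iff_algebraMap_injective _ _).2 hν
  have hmax : (m.under R).IsMaximal := Ideal.isMaximal_comap_of_isIntegral_of_isMaximal m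
  obtain ⟨a, ha⟩ := (MvPolynomial.isMaximal_iff_eq_vanishingIdeal_singleton).1 hmax
  have ha' : ∀ h : R, h ∈ m.under R ↔ MvPolynomial.eval a h = 0 := by
    intro h
    rw [ha, MvPolynomial.mem_vanishingIdeal_singleton_iff, MvPolynomial.aeval_eq_eval]
  have hne : (Ideal.span {s}).comap (algebraMap R S) ≠ ⊥ :=
    Ideal.comap_ne_bot_of_integral_mem hs (Ideal.mem_span_singleton_self s) (Algebra.IsIntegral.isIntegral s)
  obtain ⟨h, hh, hh0⟩ := Submodule.exists_mem_ne_zero_of_ne_bot hne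
  obtain ⟨c, hc⟩ := Ideal.mem_span_singleton.1 (Ideal.mem_comap.1 hh)
  obtain ⟨b, hb⟩ : ∃ b, MvPolynomial.eval b h ≠ 0 := by
    by_contra hcon
    push Not at hcon
    exact hh0 (MvPolynomial.funext (fun x => by rw [hcon x, map_zero]))
  have hha : MvPolynomial.eval a h = 0 := by
    rw [← ha']
    change algebraMap R S h ∈ m
    rw [hc]
    exact m.mul_mem_right _ hsm
  obtain ⟨j, hj⟩ : ∃ j, a j ≠ b j := by
    by_contra hcon
    push Not at hcon
    rw [← funext hcon] at hb
    exact hb hha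
  let ψ : R →ₐ[K] K[X] := MvPolynomial.aeval (fun i => C (a i) + C (b i - a i) * X)
  have hψev : ∀ (t : K) (u : R), eval t (ψ u) = MvPolynomial.eval (fun i => a i + (b i - a i) * t) u := by
    intro t u
    have : (Polynomial.aeval t).comp ψ = MvPolynomial.aeval (fun i => a i + (b i - a i) * t) := by
      ext i; simp [ψ]
    have := DFunLike.congr_fun this u
    rw [MvPolynomial.aeval_eq_eval] at this
    simpa [Polynomial.aeval_def, eval₂_eq_eval_map] using this
  have hCC : ∀ k, ψ (MvPolynomial.C k) = C k := fun k => ψ.commutes k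
  have hXX : ∀ i, ψ (MvPolynomial.X i) = C (a i) + C (b i - a i) * X := fun i => MvPolynomial.aeval_X _ i
  have hψs : Function.Surjective ψ := by
    intro p
    induction p using Polynomial.induction_on' with
    | add p q hp hq =>
      obtain ⟨p', rfl⟩ := hp
      obtain ⟨q', rfl⟩ := hq
      exact ⟨p' + q', map_add _ _ _⟩
    | monomial n k =>
      have hX : ψ (MvPolynomial.C (b j - a j)⁻¹ * (MvPolynomial.X j - MvPolynomial.C (a j))) = X := by
        have h0 : (b j - a j) ≠ 0 := sub_ne_zero.2 hj.symm
        rw [map_mul, map_sub, hCC, hCC, hXX, add_sub_cancel_left]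
        rw [← mul_assoc, ← C_mul, inv_mul_cancel₀ h0, C_1, one_mul]
      refine ⟨MvPolynomial.C k * (MvPolynomial.C (b j - a j)⁻¹ * (MvPolynomial.X j - MvPolynomial.C (a j))) ^ n, ?_⟩
      rw [map_mul, map_pow, hX, ← C_mul_X_pow_eq_monomial, hCC]
  let q0 : Ideal R := RingHom.ker ψ
  have : q0.IsPrime := RingHom.ker_isPrime _
  have hq0 : q0 ≤ m.under R := by
    intro u hu
    rw [ha']
    have h1 := hψev 0 u
    rw [(RingHom.mem_ker).1 hu] at h1
    simpa using h1.symm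
  have : (m.under R).IsPrime := hmax.isPrime
  obtain ⟨q, hqm, hqp, hqo⟩ := Ideal.exists_ideal_le_liesOver_of_le (p := q0) (q := m.under R) m hq0
  have hmemq : ∀ u : R, algebraMap R S u ∈ q ↔ ψ u = 0 := by
    intro u
    have := hqo.over
    change u ∈ q.under R ↔ _
    rw [← this]; exact RingHom.mem_ker
  have hsq : s ∉ q := by
    intro hsq
    have h1 : algebraMap R S h ∈ q := by rw [hc]; exact q.mul_mem_right _ hsq
    rw [hmemq] at h1
    have h2 := hψev 1 h
    rw [h1] at h2
    simp at h2
    exact hb h2.symm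
  let B := S ⧸ q
  let σ : R →+* B := (Ideal.Quotient.mk q).comp (algebraMap R S)
  have hσ : ∀ u, σ u = 0 ↔ ψ u = 0 := fun u => by
    rw [← hmemq]; exact Ideal.Quotient.eq_zero_iff_mem
  let e : K[X] →+* B := RingHom.liftOfSurjective (ψ : R →+* K[X]) hψs ⟨σ, fun u hu => by
    rw [RingHom.mem_ker, hσ]; exact hu⟩
  have he : ∀ u, e (ψ u) = σ u := fun u => by
    exact RingHom.liftOfRightInverse_comp_apply _ _ _ _ u
  let _ : Algebra K[X] B := e.toAlgebra
  have hinj : Function.Injective (algebraMap K[X] B) := by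
    rw [injective_iff_map_eq_zero]
    intro p hp
    obtain ⟨u, rfl⟩ := hψs p
    rw [← hσ, ← he]; exact hp
  have : Module.Finite K[X] B := by
    have h1 : (e.comp (ψ : R →+* K[X])).Finite := by
      have : e.comp (ψ : R →+* K[X]) = σ := RingHom.ext he
      rw [this]
      exact RingHom.Finite.comp (RingHom.Finite.of_surjective _ Ideal.Quotient.mk_surjective) hνf
    exact RingHom.Finite.of_comp_finite h1
  let mB : Ideal B := m.map (Ideal.Quotient.mk q)
  have hmB : mB.IsMaximal := by
    refine (Ideal.map_eq_top_or_isMaximal_of_surjective _ Ideal.Quotient.mk_surjective hm).resolve_left ?_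
    intro htop
    have h1 := congrArg (Ideal.comap (Ideal.Quotient.mk q)) htop
    rw [Ideal.comap_map_of_surjective _ Ideal.Quotient.mk_surjective, Ideal.comap_top,
      ← RingHom.ker_eq_comap_bot, Ideal.mk_ker, sup_eq_left.2 hqm] at h1
    exact hm.ne_top h1
  have hX : algebraMap K[X] B X ∈ mB := by
    obtain ⟨u, hu⟩ := hψs X
    change e X ∈ mB
    rw [← hu, he]
    apply Ideal.mem_map_of_mem
    change u ∈ m.under R
    rw [ha']
    have := hψev 0 u
    rw [hu] at this
    simpa using this.symm
  obtain ⟨D, i1, i2, i3, φ, h1, h2, h3⟩ := curve_dim1 hinj mB hX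
  refine ⟨D, i1, i2, i3, φ.comp (Ideal.Quotient.mk q), ?_, ?_, ?_⟩
  · intro h0
    apply hsq
    rw [← Ideal.Quotient.eq_zero_iff_mem]
    exact h1 (by rw [map_zero]; exact h0)
  · intro b hb
    exact h2 _ (Ideal.mem_map_of_mem _ hb)
  · intro d
    obtain ⟨k, hk⟩ := h3 d
    refine ⟨k, ?_⟩
    have : algebraMap K[X] B (C k) = Ideal.Quotient.mk q (algebraMap K S k) := by
      change e (C k) = _
      rw [← hCC, he]
      change Ideal.Quotient.mk q (ν (MvPolynomial.C k)) = _
      congr 1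
      exact ν.commutes k
    rw [this] at hk
    exact hk


/-- The approximation condition. -/
def AA (K : Type) [Field K] {n m : ℕ} (f : Fin n → MvPolynomial (Fin m) ℤ)
    (g : MvPolynomial (Fin m) ℤ) : Prop :=
  ∃ N : ℕ, ∃ P : Fin m → Polynomial K, (∀ l, Polynomial.X ^ N ∣ MvPolynomial.aeval P (f l)) ∧
    ¬ Polynomial.X ^ N ∣ MvPolynomial.aeval P g

open Polynomial in
theorem dvr_approx {K D : Type} [Field K] [CommRing D] [IsDomain D] [IsDiscreteValuationRing D]
    (ι : K →+* D) (hres : ∀ d : D, ∃ k : K, d - ι k ∈ IsLocalRing.maximalIdeal D)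
    (t : D) (ht : Irreducible t) (N : ℕ) (x : D) :
    ∃ P : K[X], t ^ N ∣ x - eval₂ ι t P := by
  induction N generalizing x with
  | zero => exact ⟨0, by simp⟩
  | succ N ih =>
    obtain ⟨k, hk⟩ := hres x
    rw [ht.maximalIdeal_eq, Ideal.mem_span_singleton] at hk
    obtain ⟨y, hy⟩ := hk
    obtain ⟨P, z, hP⟩ := ih y
    refine ⟨C k + X * P, z, ?_⟩
    rw [eval₂_add, eval₂_mul, eval₂_X, eval₂_C, pow_succ, ← sub_sub, hy, ← mul_sub, hP]
    ring

open Polynomial in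
theorem dvr_X_dvd {K D : Type} [Field K] [CommRing D] [IsDomain D] [IsDiscreteValuationRing D]
    (ι : K →+* D) (t : D) (ht : Irreducible t) (N : ℕ) (h : K[X])
    (hd : t ^ N ∣ eval₂ ι t h) : X ^ N ∣ h := by
  induction N generalizing h with
  | zero => simp
  | succ N ih =>
    have h0 : h.coeff 0 = 0 := by
      by_contra hne
      have h1 : t ∣ eval₂ ι t h := (dvd_pow_self t (Nat.succ_ne_zero N)).trans hd
      rw [← X_mul_divX_add h, eval₂_add, eval₂_mul, eval₂_X, eval₂_C] at h1
      have h2 : t ∣ ι (h.coeff 0) := (dvd_add_right (Dvd.intro _ rfl)).1 h1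
      exact ht.not_isUnit (isUnit_of_dvd_unit h2 ((IsUnit.mk0 _ hne).map ι))
    have hX : h = X * h.divX := by
      conv_lhs => rw [← X_mul_divX_add h, h0, C_0, add_zero]
    rw [hX] at hd ⊢
    rw [eval₂_mul, eval₂_X, pow_succ'] at hd
    rw [pow_succ']
    exact mul_dvd_mul_left _ (ih _ ((mul_dvd_mul_iff_left ht.ne_zero).1 hd))

open Polynomial in
theorem AA_of_dvr {K D : Type} [Field K] [CommRing D] [IsDomain D] [IsDiscreteValuationRing D]
    (ι : K →+* D) (hres : ∀ d : D, ∃ k : K, d - ι k ∈ IsLocalRing.maximalIdeal D)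
    {n m : ℕ} (f : Fin n → MvPolynomial (Fin m) ℤ) (g : MvPolynomial (Fin m) ℤ)
    (x : Fin m → D) (hg : MvPolynomial.aeval x g ≠ 0)
    (y : Fin n → D) (hy : ∀ l, y l ∈ IsLocalRing.maximalIdeal D)
    (hf : ∀ l, MvPolynomial.aeval x (f l) = MvPolynomial.aeval x g * y l) : AA K f g := by
  obtain ⟨t, ht⟩ := IsDiscreteValuationRing.exists_irreducible D
  obtain ⟨e, he⟩ := IsDiscreteValuationRing.associated_pow_irreducible hg ht
  choose P hP using fun j => dvr_approx ι hres t ht (e + 1) (x j)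
  have key : ∀ h : MvPolynomial (Fin m) ℤ,
      t ^ (e + 1) ∣ MvPolynomial.aeval x h ↔ t ^ (e + 1) ∣ eval₂ ι t (MvPolynomial.aeval P h) := by
    intro h
    have h1 : eval₂ ι t (MvPolynomial.aeval P h) = MvPolynomial.aeval (fun j => eval₂ ι t (P j)) h :=
      ringHom_aeval (eval₂RingHom ι t) P h
    rw [h1, ← Ideal.mem_span_singleton, ← Ideal.mem_span_singleton, ← Ideal.Quotient.eq_zero_iff_mem,
      ← Ideal.Quotient.eq_zero_iff_mem, ringHom_aeval, ringHom_aeval]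
    have h2 : (fun j => Ideal.Quotient.mk (Ideal.span {t ^ (e + 1)}) (x j)) =
        fun j => Ideal.Quotient.mk (Ideal.span {t ^ (e + 1)}) (eval₂ ι t (P j)) := by
      funext j
      rw [Ideal.Quotient.eq, Ideal.mem_span_singleton]
      exact hP j
    rw [h2]
  refine ⟨e + 1, P, fun l => ?_, fun hd => ?_⟩
  · apply dvr_X_dvd ι t ht
    rw [← key, hf, pow_succ]
    have h3 := hy l
    rw [ht.maximalIdeal_eq, Ideal.mem_span_singleton] at h3
    exact mul_dvd_mul he.symm.dvd h3
  · obtain ⟨w, hw⟩ := hd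
    have h4 : t ^ (e + 1) ∣ eval₂ ι t (MvPolynomial.aeval P g) := by
      rw [hw, eval₂_mul, eval₂_X_pow]
      exact Dvd.intro _ rfl
    rw [← key] at h4
    have h5 := h4.trans he.dvd
    have := (pow_dvd_pow_iff ht.ne_zero ht.not_isUnit).1 h5
    omega


open MvPolynomial in
theorem exists_q (K : Type) [Field K] [IsAlgClosed K] [CharZero K] {n m : ℕ}
    (f : Fin n → MvPolynomial (Fin m) ℤ) (g : MvPolynomial (Fin m) ℤ) (hA : ¬ AA K f g) :
    ∃ q : Fin n → MvPolynomial (Fin m ⊕ Fin n) K, ∀ x : Fin m → K, aeval x g ≠ 0 →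
      ∑ i, (aeval x (f i) / aeval x g) *
        eval (Sum.elim x (fun j => aeval x (f j) / aeval x g)) (q i) = 1 := by
  classical
  let ev : ∀ x : Fin m → K, MvPolynomial (Fin m) K →+* K := fun x => eval x
  have hev : ∀ (x : Fin m → K) (h : MvPolynomial (Fin m) ℤ),
      eval x (aeval (X : Fin m → MvPolynomial (Fin m) K) h) = aeval x h := by
    intro x h
    rw [ringHom_aeval]
    simp
  by_cases hG : (aeval (X : Fin m → MvPolynomial (Fin m) K) g) = 0
  · refine ⟨0, fun x hx => absurd ?_ hx⟩
    rw [← hev, hG, map_zero]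
  generalize hGG : (aeval (X : Fin m → MvPolynomial (Fin m) K) g) = G at hG
  have hle : Submonoid.powers G ≤ nonZeroDivisors (MvPolynomial (Fin m) K) :=
    powers_le_nonZeroDivisors_of_noZeroDivisors hG
  have hdom : IsDomain (Localization.Away G) := IsLocalization.isDomain_localization hle
  let am : MvPolynomial (Fin m) K →+* Localization.Away G := algebraMap _ _
  have ham : Function.Injective am := IsLocalization.injective _ hle
  obtain ⟨w, hw⟩ : ∃ w : Fin n → Localization.Away G, ∀ i, am (aeval X (f i)) = am G * w i := by
    refine ⟨fun i => am (aeval X (f i)) * IsLocalization.Away.invSelf G, fun i => ?_⟩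
    have : am G * IsLocalization.Away.invSelf G = 1 := IsLocalization.Away.mul_invSelf G
    rw [mul_left_comm, this, mul_one]
  let ρ : MvPolynomial (Fin m ⊕ Fin n) K →ₐ[K] Localization.Away G :=
    aeval (Sum.elim (fun j => am (X j)) w)
  let S := ρ.range
  let ρ' : MvPolynomial (Fin m ⊕ Fin n) K →ₐ[K] S := ρ.rangeRestrict
  have hρ' : Function.Surjective ρ' := ρ.rangeRestrict_surjective
  have hft : Algebra.FiniteType K S := Algebra.FiniteType.of_surjective ρ' hρ'
  have hval : ∀ u, ((ρ' u : S) : Localization.Away G) = ρ u := fun u => rfl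
  have hY : ∀ i, ρ (X (Sum.inr i)) = w i := fun i => by simp [ρ]
  have hXl : ∀ h : MvPolynomial (Fin m) ℤ, ρ (aeval (fun j => X (Sum.inl j)) h) = am (aeval X h) := by
    intro h
    have h1 := ringHom_aeval ρ.toRingHom (fun j => X (Sum.inl j)) h
    have h2 := ringHom_aeval am X h
    rw [h2]
    refine h1.trans ?_
    congr 2
    funext j
    change ρ (X (Sum.inl j)) = _
    simp [ρ]
  by_cases hJ : Ideal.span (Set.range fun i => ρ' (X (Sum.inr i))) = ⊤
  · have h1 : (1 : S) ∈ Ideal.span (Set.range fun i => ρ' (X (Sum.inr i))) := by rw [hJ]; trivial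
    rw [Ideal.mem_span_range_iff_exists_fun] at h1
    obtain ⟨c, hc⟩ := h1
    choose q hq using fun i => hρ' (c i)
    refine ⟨q, fun x hx => ?_⟩
    have hu : IsUnit (ev x G) := by
      refine IsUnit.mk0 _ ?_
      change eval x G ≠ 0
      rw [← hGG, hev]; exact hx
    let lx : Localization.Away G →+* K := IsLocalization.Away.lift G hu
    have hlx : ∀ u, lx (am u) = eval x u := fun u => IsLocalization.Away.lift_eq G hu u
    have hwx : ∀ i, lx (w i) = aeval x (f i) / aeval x g := by
      intro i
      rw [eq_div_iff hx, ← hev x (f i), ← hev x g, hGG, ← hlx, ← hlx, hw, mul_comm, ← map_mul]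
    have hcomp : ∀ u, lx (ρ u) = eval (Sum.elim x (fun j => aeval x (f j) / aeval x g)) u := by
      intro u
      have : lx.comp (ρ : MvPolynomial (Fin m ⊕ Fin n) K →+* _) =
          eval (Sum.elim x (fun j => aeval x (f j) / aeval x g)) := by
        apply MvPolynomial.ringHom_ext
        · intro k
          have : ρ (C k) = am (C k) := ρ.commutes k
          change lx (ρ (C k)) = _
          rw [this, hlx]; simp
        · rintro (j | j)
          · have : ρ (X (Sum.inl j)) = am (X j) := by simp [ρ]
            change lx (ρ (X (Sum.inl j))) = _
            rw [this, hlx]; simp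
          · change lx (ρ (X (Sum.inr j))) = _
            rw [hY, hwx]; simp
      exact DFunLike.congr_fun this u
    have h2 := congrArg (fun s : S => lx (s : Localization.Away G)) hc
    simp only [← hq] at h2
    rw [AddSubmonoidClass.coe_finsetSum, map_sum] at h2
    have h3 : lx ((1 : S) : Localization.Away G) = 1 := map_one lx
    rw [h3] at h2
    rw [← h2]
    refine Finset.sum_congr rfl fun i _ => ?_
    have h4 : ((ρ' (q i) * ρ' (X (Sum.inr i)) : S) : Localization.Away G) = ρ (q i) * w i := by
      rw [← hY]; rfl
    rw [h4, map_mul, hcomp, hwx, mul_comm]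
  · exfalso
    apply hA
    obtain ⟨M, hM, hJM⟩ := Ideal.exists_le_maximal _ hJ
    have hYM : ∀ i, ρ' (X (Sum.inr i)) ∈ M := fun i => hJM (Ideal.subset_span ⟨i, rfl⟩)
    let x : Fin m → S := fun j => ρ' (X (Sum.inl j))
    have hx : ∀ h : MvPolynomial (Fin m) ℤ, aeval x h = ρ' (aeval (fun j => X (Sum.inl j)) h) := by
      intro h
      exact (ringHom_aeval (ρ' : MvPolynomial (Fin m ⊕ Fin n) K →+* S) (fun j => X (Sum.inl j)) h).symm
    have hgne : aeval x g ≠ 0 := by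
      intro h0
      rw [hx] at h0
      have h1 := congrArg Subtype.val h0
      rw [hval, hXl, hGG] at h1
      exact hG (ham (h1.trans (map_zero am).symm))
    have hrel : ∀ l, aeval x (f l) = aeval x g * ρ' (X (Sum.inr l)) := by
      intro l
      rw [hx, hx, ← map_mul]
      apply Subtype.ext
      rw [hval, hval, map_mul, hXl, hXl, hY, hGG, hw]
    by_cases hgM : aeval x g ∈ M
    · obtain ⟨D, _, _, _, φ, h1, h2, h3⟩ := curve (K := K) M (aeval x g) hgne hgM
      refine AA_of_dvr (φ.comp (algebraMap K S)) h3 f g (fun j => φ (x j)) ?_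
        (fun l => φ (ρ' (X (Sum.inr l)))) (fun l => h2 _ (hYM l)) ?_
      · rw [← ringHom_aeval]; exact h1
      · intro l
        rw [← ringHom_aeval, ← ringHom_aeval, hrel, map_mul]
    · have hmax : (M.comap ρ').IsMaximal := Ideal.comap_isMaximal_of_surjective ρ' hρ'
      obtain ⟨a, ha⟩ := MvPolynomial.isMaximal_iff_eq_vanishingIdeal_singleton.1 hmax
      have ha' : ∀ u, ρ' u ∈ M ↔ eval a u = 0 := by
        intro u
        rw [← Ideal.mem_comap, ha, MvPolynomial.mem_vanishingIdeal_singleton_iff,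
          MvPolynomial.aeval_eq_eval]
      have hea : ∀ h : MvPolynomial (Fin m) ℤ, aeval x h ∈ M ↔ aeval (fun j => a (Sum.inl j)) h = 0 := by
        intro h
        rw [hx, ha', ringHom_aeval]
        simp
      refine ⟨1, fun j => Polynomial.C (a (Sum.inl j)), fun l => ?_, ?_⟩
      · rw [← ringHom_aeval, (hea (f l)).1, Polynomial.C_0]
        · exact dvd_zero _
        · rw [hrel]; exact M.mul_mem_left _ (hYM l)
      · rw [← ringHom_aeval, pow_one, Polynomial.X_dvd_iff, Polynomial.coeff_C_zero, ← hea]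
        exact hgM


open Polynomial in
theorem solve_F (L : Type) [Field L] [CharZero L] [IsAlgClosed L] [Algebra.IsAlgebraic ℚ L]
    (p : ℕ) [hp : Fact p.Prime] (F : Type) [Field F] [Finite F] [CharP F p] {n m : ℕ} (hn : 1 ≤ n)
    (f g : Fin n → MvPolynomial (Fin m) ℤ) (hA : ∀ i, AA F f (g i)) :
    ∃ x : Fin m → ZGM L p, ∀ i, MvPolynomial.aeval x (f i) = 0 ∧ MvPolynomial.aeval x (g i) ≠ 0 := by
  classical
  choose N P hf hg using hA
  have hg' : ∀ i, ∃ e, e < N i ∧ (MvPolynomial.aeval (P i) (g i)).coeff e ≠ 0 := by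
    intro i
    have := hg i
    rw [X_pow_dvd_iff] at this
    push Not at this
    exact this
  choose e he hc using hg'
  let k := ∑ i, N i ^ 2
  let H := (p ^ (k + 1)).totient
  have hH : ∀ i, N i ^ 2 ≤ H := by
    intro i
    have h1 : N i ^ 2 ≤ k := Finset.single_le_sum (f := fun i => N i ^ 2) (fun _ _ => Nat.zero_le _) (Finset.mem_univ i)
    have h2 : k < p ^ k := Nat.lt_pow_self hp.out.one_lt
    have h3 : H = p ^ k * (p - 1) := Nat.totient_prime_pow_succ hp.out k
    have h4 : 1 ≤ p - 1 := by have := hp.out.two_le; omega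
    rw [h3]
    nlinarith
  have hr : ∀ i, ∃ r, 0 < r ∧ H ≤ r * N i ∧ r * e i < H := by
    intro i
    have hNpos : 0 < N i := lt_of_le_of_lt (Nat.zero_le _) (he i)
    have hHi := hH i
    refine ⟨(H + N i - 1) / N i, ?_, ?_, ?_⟩
    · apply Nat.div_pos _ hNpos
      have : 0 < N i ^ 2 := by positivity
      omega
    · have h1 := Nat.div_add_mod (H + N i - 1) (N i)
      have h2 := Nat.mod_lt (H + N i - 1) hNpos
      rw [mul_comm]
      omega
    · have h1 := Nat.div_mul_le_self (H + N i - 1) (N i)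
      have h2 : N i ≤ (H + N i - 1) / N i := by
        rw [Nat.le_div_iff_mul_le hNpos]
        have : N i * N i = N i ^ 2 := by ring
        omega
      generalize (H + N i - 1) / N i = r at h1 h2
      have h3 : r * e i + r ≤ r * N i := by
        rw [← Nat.mul_succ]
        exact Nat.mul_le_mul_left _ (he i)
      omega
  choose r hr0 hrN hre using hr
  let Q : Fin m → (Fin n → F)[X] := fun j => (piEquiv (fun _ : Fin n => F)).symm (fun i => expand F (r i) (P i j))
  have hQ : ∀ j i, (Q j).map (Pi.evalRingHom (fun _ : Fin n => F) i) = expand F (r i) (P i j) := by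
    intro j i
    exact congrFun ((piEquiv (fun _ : Fin n => F)).apply_symm_apply (fun i => expand F (r i) (P i j))) i
  have hcoeff : ∀ (h : MvPolynomial (Fin m) ℤ) (d : ℕ) (i : Fin n),
      (MvPolynomial.aeval Q h).coeff d i = (expand F (r i) (MvPolynomial.aeval (P i) h)).coeff d := by
    intro h d i
    have h1 : (MvPolynomial.aeval Q h).map (Pi.evalRingHom (fun _ : Fin n => F) i) = expand F (r i) (MvPolynomial.aeval (P i) h) := by
      have h2 := ringHom_aeval (mapRingHom (Pi.evalRingHom (fun _ : Fin n => F) i)) Q h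
      have h3 := ringHom_aeval (expand F (r i)).toRingHom (P i) h
      refine h2.trans (Eq.trans ?_ h3.symm)
      congr 2
      funext j
      exact hQ j i
    rw [← h1, coeff_map]
    rfl
  obtain ⟨π, hπ0, hπ1⟩ := exists_pi L p k
  obtain ⟨M, hM, θ₁, hθ₁⟩ := exists_FF p F n hn
  obtain ⟨θ₂, hθ₂⟩ := cyc_inj L p M hM
  let θ : (Fin n → F) →+* ZGM L p := θ₂.comp θ₁
  have hθ : Function.Injective θ := hθ₂.comp hθ₁
  have hev : ∀ h : MvPolynomial (Fin m) ℤ,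
      MvPolynomial.aeval (fun j => eval₂ θ π (Q j)) h = eval₂ θ π (MvPolynomial.aeval Q h) := fun h =>
    (ringHom_aeval (eval₂RingHom θ π) Q h).symm
  refine ⟨fun j => eval₂ θ π (Q j), fun l => ⟨?_, ?_⟩⟩
  · rw [hev]
    have hd : X ^ H ∣ MvPolynomial.aeval Q (f l) := by
      rw [X_pow_dvd_iff]
      intro d hd
      funext i
      rw [hcoeff, coeff_expand (hr0 i)]
      split_ifs with hdv
      · refine X_pow_dvd_iff.1 (hf i l) _ ?_
        rw [Nat.div_lt_iff_lt_mul (hr0 i), mul_comm]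
        exact lt_of_lt_of_le hd (hrN i)
      · rfl
    obtain ⟨w, hw⟩ := hd
    rw [hw, eval₂_mul, eval₂_X_pow, hπ0, zero_mul]
  · rw [hev]
    intro h0
    have h1 := eval_pi θ hθ π H hπ0 hπ1 _ h0 (r l * e l) (hre l)
    have h2 := congrFun h1 l
    rw [hcoeff, coeff_expand_mul' (hr0 l)] at h2
    exact hc l h2


open Polynomial in
theorem reduce_AA (L : Type) [Field L] [CharZero L] [IsAlgClosed L] [Algebra.IsAlgebraic ℚ L]
    {n m : ℕ} (f g : Fin n → MvPolynomial (Fin m) ℤ) (hA : ∀ i, AA L f (g i)) :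
    ∃ D : ℕ, D ≠ 0 ∧ ∀ p : ℕ, p.Prime → ¬ p ∣ D → ∃ (F : Type) (_ : Field F) (_ : Finite F)
      (_ : CharP F p), ∀ i, AA F f (g i) := by
  classical
  choose N P hf hg using hA
  have hg' : ∀ i, ∃ e, e < N i ∧ (MvPolynomial.aeval (P i) (g i)).coeff e ≠ 0 := by
    intro i
    have := hg i
    rw [X_pow_dvd_iff] at this
    push Not at this
    exact this
  choose e he hc using hg'
  let S : Finset L := (Finset.univ.biUnion fun i => Finset.univ.biUnion fun j => (P i j).coeffs) ∪
    Finset.univ.image fun i => ((MvPolynomial.aeval (P i) (g i)).coeff (e i))⁻¹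
  let R := Algebra.adjoin ℤ (S : Set L)
  have hft : Algebra.FiniteType ℤ R := ⟨(Subalgebra.fg_top R).2 ⟨S, rfl⟩⟩
  have hSR : ∀ a ∈ S, a ∈ R := fun a ha => Algebra.subset_adjoin ha
  have hPR : ∀ i j d, (P i j).coeff d ∈ R := by
    intro i j d
    by_cases h0 : (P i j).coeff d = 0
    · rw [h0]; exact R.zero_mem
    · refine hSR _ (Finset.mem_union_left _ (Finset.mem_biUnion.2 ⟨i, Finset.mem_univ _,
        Finset.mem_biUnion.2 ⟨j, Finset.mem_univ _, coeff_mem_coeffs h0⟩⟩))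
  have hinv : ∀ i, ((MvPolynomial.aeval (P i) (g i)).coeff (e i))⁻¹ ∈ R := fun i =>
    hSR _ (Finset.mem_union_right _ (Finset.mem_image_of_mem _ (Finset.mem_univ i)))
  let ι : R →+* L := algebraMap R L
  have hι : Function.Injective ι := Subtype.val_injective
  have hlift : ∀ i j, ∃ Q : R[X], Q.map ι = P i j := by
    intro i j
    have : P i j ∈ lifts ι := by
      rw [lifts_iff_coeff_lifts]
      intro d
      exact ⟨⟨_, hPR i j d⟩, rfl⟩
    exact (mem_lifts _).1 this
  choose Q hQ using hlift
  have hQa : ∀ i (h : MvPolynomial (Fin m) ℤ), (MvPolynomial.aeval (Q i) h).map ι = MvPolynomial.aeval (P i) h := by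
    intro i h
    have h1 := ringHom_aeval (mapRingHom ι) (Q i) h
    refine h1.trans ?_
    congr 2
    funext j
    exact hQ i j
  obtain ⟨D, hD0, hD⟩ := V_all_but_finset L S
  refine ⟨D, hD0, fun p hp hpD => ?_⟩
  have hpf : Fact p.Prime := ⟨hp⟩
  obtain ⟨V, hV⟩ := exists_V L p
  have hSV := hD p hp hpD V hV
  have hRV : ∀ a ∈ R, a ∈ V := by
    intro a ha
    refine Algebra.adjoin_induction (p := fun x _ => x ∈ V) (fun x hx => hSV x hx) ?_ (fun x y _ _ hx hy => V.add_mem _ _ hx hy)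
      (fun x y _ _ hx hy => V.mul_mem _ _ hx hy) ha
    intro z
    rw [eq_intCast]
    exact intCast_mem V z
  have hI : Ideal.span {(p : R)} ≠ ⊤ := by
    rw [Ne, Ideal.span_singleton_eq_top]
    intro hu
    obtain ⟨u, hu⟩ := hu.exists_right_inv
    have h1 : (p : L) * (u : L) = 1 := by
      have := congrArg ι hu
      rw [map_mul, map_natCast, map_one] at this
      exact this
    have h2 := (V.valuation_le_one_iff _).2 (hRV u u.2)
    have h3 : V.valuation (p : L) * V.valuation (u : L) = 1 := by rw [← map_mul, h1, map_one]
    have h4 := mul_lt_one_of_nonneg_of_lt_one_left zero_le hV h2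
    rw [h3] at h4
    exact lt_irrefl _ h4
  obtain ⟨M, hM, hpM⟩ := Ideal.exists_le_maximal _ hI
  let F := R ⧸ M
  let _ : Field F := Ideal.Quotient.field M
  have hp0 : (p : F) = 0 := by
    have : (Ideal.Quotient.mk M) (p : R) = 0 := Ideal.Quotient.eq_zero_iff_mem.2 (hpM (Ideal.mem_span_singleton_self _))
    rw [← this, map_natCast]
  have hch : CharP F p := by
    have h := CharP.exists F
    obtain ⟨q, hq⟩ := h
    have h1 := (CharP.cast_eq_zero_iff F q p).1 hp0
    rcases (Nat.dvd_prime hp).1 h1 with h2 | h2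
    · exact absurd h2 (CharP.char_ne_one F q)
    · rw [← h2]; exact hq
  let _ : Algebra (ZMod p) F := ZMod.algebra F p
  have hft2 : Algebra.FiniteType ℤ F := Algebra.FiniteType.of_surjective (Ideal.Quotient.mkₐ ℤ M) (Ideal.Quotient.mkₐ_surjective ℤ M)
  have hft3 : Algebra.FiniteType (ZMod p) F := Algebra.FiniteType.of_restrictScalars_finiteType ℤ (ZMod p) F
  have hmf : Module.Finite (ZMod p) F := finite_of_finite_type_of_isJacobsonRing _ _
  have hfin : Finite F := Module.finite_of_finite (ZMod p)
  refine ⟨F, inferInstance, hfin, hch, fun i => ⟨N i, fun j => (Q i j).map (Ideal.Quotient.mk M), fun l => ?_, ?_⟩⟩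
  · have h1 := ringHom_aeval (mapRingHom (Ideal.Quotient.mk M)) (Q i) (f l)
    have h2 : (X : F[X]) ^ N i ∣ (MvPolynomial.aeval (Q i) (f l)).map (Ideal.Quotient.mk M) := by
      rw [X_pow_dvd_iff]
      intro d hd
      have h3 := X_pow_dvd_iff.1 (hf i l) d hd
      rw [← hQa, coeff_map, map_eq_zero_iff ι hι] at h3
      rw [coeff_map, h3, map_zero]
    exact h1 ▸ h2
  · have h1 := ringHom_aeval (mapRingHom (Ideal.Quotient.mk M)) (Q i) (g i)
    have h2 : ¬ (X : F[X]) ^ N i ∣ (MvPolynomial.aeval (Q i) (g i)).map (Ideal.Quotient.mk M) := by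
      rw [X_pow_dvd_iff]
      intro h3
      have h4 := h3 (e i) (he i)
      rw [coeff_map] at h4
      have h5 : (MvPolynomial.aeval (Q i) (g i)).coeff (e i) * ⟨_, hinv i⟩ = 1 := by
        apply hι
        rw [map_mul, ← coeff_map, hQa, map_one]
        exact mul_inv_cancel₀ (hc i)
      have h6 := congrArg (Ideal.Quotient.mk M) h5
      rw [map_mul, h4, zero_mul, map_one] at h6
      exact zero_ne_one h6
    exact h1 ▸ h2

theorem main_abs (L : Type) [Field L] [CharZero L] [IsAlgClosed L] [Algebra.IsAlgebraic ℚ L]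
    {n m : ℕ} (hn : 1 ≤ n) (f g : Fin n → MvPolynomial (Fin m) ℤ) :
    {p : ℕ | p.Prime ∧ ∃ x : Fin m → ZGM L p, ∀ i : Fin n,
      MvPolynomial.aeval x (f i) = 0 ∧ MvPolynomial.aeval x (g i) ≠ 0}.Finite ∨
    ({p : ℕ | p.Prime} \ {p : ℕ | p.Prime ∧ ∃ x : Fin m → ZGM L p, ∀ i : Fin n,
      MvPolynomial.aeval x (f i) = 0 ∧ MvPolynomial.aeval x (g i) ≠ 0}).Finite := by
  by_cases hA : ∀ i, AA L f (g i)
  · right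
    obtain ⟨D, hD0, hD⟩ := reduce_AA L f g hA
    refine (Nat.divisors D).finite_toSet.subset ?_
    rintro p ⟨hp, hnot⟩
    rw [Finset.mem_coe, Nat.mem_divisors]
    refine ⟨?_, hD0⟩
    by_contra hpD
    apply hnot
    have hp' : p.Prime := hp
    have : Fact p.Prime := ⟨hp'⟩
    obtain ⟨F, _, _, _, hF⟩ := hD p hp' hpD
    exact ⟨hp', solve_F L p F hn f g hF⟩
  · left
    push Not at hA
    obtain ⟨i, hi⟩ := hA
    obtain ⟨q, hq⟩ := exists_q L f (g i) hi
    obtain ⟨D, hD0, hD⟩ := fin_case L f (g i) q hq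
    refine (Nat.divisors D).finite_toSet.subset ?_
    rintro p ⟨hp, x, hx⟩
    rw [Finset.mem_coe, Nat.mem_divisors]
    refine ⟨?_, hD0⟩
    by_contra hpD
    exact (hx i).2 (hD p hp hpD x (fun l => (hx l).1))


end Helpers

/-- Fix `n, m ≥ 1` and integer polynomials `f i, g i`. The set of primes
`p` for which the system `f i = 0, g i ≠ 0` has a solution in `ℤ^ab/pℤ^ab` is either
finite, or contains all but finitely many primes. -/
theorem stmt2 (n m : ℕ) (hn : 1 ≤ n) (hm : 1 ≤ m)
    (f g : Fin n → MvPolynomial (Fin m) ℤ) :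
    {p : ℕ | p.Prime ∧ ∃ x : Fin m → ZabMod p, ∀ i : Fin n,
        MvPolynomial.aeval x (f i) = 0 ∧ MvPolynomial.aeval x (g i) ≠ 0}.Finite ∨
    ({p : ℕ | p.Prime} \ {p : ℕ | p.Prime ∧ ∃ x : Fin m → ZabMod p, ∀ i : Fin n,
        MvPolynomial.aeval x (f i) = 0 ∧ MvPolynomial.aeval x (g i) ≠ 0}).Finite := by
  have hsub : Subsingleton (Algebra ℚ (AlgebraicClosure ℚ)) := inferInstance
  have halg : @Algebra.IsAlgebraic ℚ (AlgebraicClosure ℚ) _ _ DivisionRing.toRatAlgebra := by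
    rw [Subsingleton.elim (DivisionRing.toRatAlgebra : Algebra ℚ (AlgebraicClosure ℚ))
      (AlgebraicClosure.instAlgebra ℚ)]
    exact AlgebraicClosure.isAlgebraic ℚ
  have hch : CharZero (AlgebraicClosure ℚ) := inferInstance
  exact main_abs (AlgebraicClosure ℚ) hn f g

end
end

section
/- Fix a prime p and fix an algebraic closure ℚ̄ of ℚ. Let ℤ[ζ_{∞'}] be the subring of ℚ̄ generated by all roots of unity of order coprime to p, and R_p = ℤ[ζ_{∞'}]/pℤ[ζ_{∞'}]. Then there is a ring isomorphism ℤ^ab/pℤ^ab ≅ R_p[t^{1/p^∞}]/(t^{p−1}), where the right-hand side is the direct limit over n ∈ ℕ of the rings R_p[X]/(X^{p^n(p−1)}) with transition maps induced by X ↦ X^p. -/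
noncomputable section

/-- `ℤ[ζ_{∞'}]`: the subring of a fixed algebraic closure of `ℚ` generated by all roots of
unity of order coprime to `p`. -/
noncomputable def Zcop (p : ℕ) : Subring (AlgebraicClosure ℚ) :=
  Subring.closure {x : AlgebraicClosure ℚ | ∃ n : ℕ, 0 < n ∧ Nat.Coprime n p ∧ x ^ n = 1}

/-- `R_p = ℤ[ζ_{∞'}] / p ℤ[ζ_{∞'}]`. -/
noncomputable abbrev Rp (p : ℕ) : Type :=
  Zcop p ⧸ Ideal.span {(p : Zcop p)}

/-- The ring hom `R[X]/(X^a) →+* R[X]/(X^b)` induced by `X ↦ X^k`, well defined when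
`b ≤ a * k`. -/
noncomputable def powQuotMap (R : Type*) [CommRing R] (a b k : ℕ) (h : b ≤ a * k) :
    (Polynomial R ⧸ Ideal.span {(Polynomial.X : Polynomial R) ^ a}) →+*
      (Polynomial R ⧸ Ideal.span {(Polynomial.X : Polynomial R) ^ b}) :=
  Ideal.Quotient.lift _
    ((Ideal.Quotient.mk _).comp (Polynomial.eval₂RingHom Polynomial.C (Polynomial.X ^ k)))
    (fun f hf => by
      rw [Ideal.mem_span_singleton] at hf
      obtain ⟨g, rfl⟩ := hf
      simp only [RingHom.comp_apply, Polynomial.coe_eval₂RingHom, Polynomial.eval₂_mul,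
        Polynomial.eval₂_pow, Polynomial.eval₂_X]
      rw [← pow_mul, Ideal.Quotient.eq_zero_iff_mem]
      exact Ideal.mul_mem_right _ _
        (Ideal.mem_span_singleton.2 (pow_dvd_pow _ (le_trans h (le_of_eq (mul_comm a k))))))

/-- `R[t^{1/p^∞}]/(t^{p-1})`: the direct limit over `n : ℕ` of the rings
`R[X]/(X^{p^n(p-1)})`, with transition maps induced by `X ↦ X^p`
(from stage `n` to stage `m` the map is induced by `X ↦ X^{p^{m-n}}`). -/
noncomputable abbrev PerfQuot (R : Type*) [CommRing R] (p : ℕ) : Type _ :=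
  Ring.DirectLimit
    (fun n : ℕ => Polynomial R ⧸ Ideal.span {(Polynomial.X : Polynomial R) ^ (p ^ n * (p - 1))})
    (fun n m hnm => powQuotMap R (p ^ n * (p - 1)) (p ^ m * (p - 1)) (p ^ (m - n))
      (le_of_eq (by rw [mul_right_comm, ← pow_add, Nat.add_sub_cancel' hnm])))


open Polynomial IntermediateField in
theorem aux_degree {k L : Type*} [Field k] [CharZero k] [Field L] [CharZero L]
    [Algebra k L] [Algebra.IsIntegral k L]
    (hirr : ∀ n : ℕ, 0 < n → Irreducible (cyclotomic n k))
    {N M : ℕ} (hN : 0 < N) (hM : 0 < M) (hc : Nat.Coprime N M) {η ζ : L} (hη : IsPrimitiveRoot η N) (hζ : IsPrimitiveRoot ζ M) :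
    M.totient ≤ (minpoly k⟮η⟯ ζ).natDegree := by
  have : NeZero N := ⟨hN.ne'⟩
  have : NeZero M := ⟨hM.ne'⟩
  have : NeZero (N * M) := ⟨(Nat.mul_pos hN hM).ne'⟩
  have h1 : IsPrimitiveRoot (η * ζ) (N * M) := by
    rw [IsPrimitiveRoot.iff_orderOf,
      (Commute.all η ζ).orderOf_mul_eq_mul_orderOf_of_coprime, ← hη.eq_orderOf, ← hζ.eq_orderOf]
    rwa [← hη.eq_orderOf, ← hζ.eq_orderOf]
  have c1 := hη.intermediateField_adjoin_isCyclotomicExtension k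
  have c2 := h1.intermediateField_adjoin_isCyclotomicExtension k
  have f1 : Module.finrank k k⟮η⟯ = N.totient :=
    IsCyclotomicExtension.finrank (n := N) (K := k) k⟮η⟯ (hirr _ hN)
  have f2 : Module.finrank k k⟮η * ζ⟯ = (N * M).totient := 
    IsCyclotomicExtension.finrank _ (hirr _ (Nat.mul_pos hN hM))
  have iη : IsIntegral k η := Algebra.IsIntegral.isIntegral η
  have iζ : IsIntegral k⟮η⟯ ζ := (Algebra.IsIntegral.isIntegral (R := k) ζ).tower_top
  have : FiniteDimensional k k⟮η⟯ := adjoin.finiteDimensional iη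
  have : FiniteDimensional k⟮η⟯ k⟮η⟯⟮ζ⟯ := adjoin.finiteDimensional iζ
  have : FiniteDimensional k k⟮η⟯⟮ζ⟯ := FiniteDimensional.trans k k⟮η⟯ _
  have f3 : Module.finrank k k⟮η⟯ * Module.finrank k⟮η⟯ k⟮η⟯⟮ζ⟯ = Module.finrank k k⟮η⟯⟮ζ⟯ :=
    Module.finrank_mul_finrank _ _ _
  rw [adjoin.finrank iζ, f1] at f3
  have hle : k⟮η * ζ⟯ ≤ (k⟮η⟯⟮ζ⟯).restrictScalars k := by
    rw [adjoin_simple_le_iff]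
    apply mul_mem
    · exact (k⟮η⟯⟮ζ⟯).algebraMap_mem ⟨η, mem_adjoin_simple_self k η⟩
    · exact mem_adjoin_simple_self k⟮η⟯ ζ
  have : FiniteDimensional k ((k⟮η⟯⟮ζ⟯).restrictScalars k) := 
    inferInstanceAs (FiniteDimensional k k⟮η⟯⟮ζ⟯)
  have f4 : Module.finrank k k⟮η * ζ⟯ ≤ Module.finrank k ((k⟮η⟯⟮ζ⟯).restrictScalars k) :=
    LinearMap.finrank_le_finrank_of_injective
      (f := (IntermediateField.inclusion hle).toLinearMap)
      (IntermediateField.inclusion hle).injective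
  change _ ≤ Module.finrank k k⟮η⟯⟮ζ⟯ at f4
  rw [f2, Nat.totient_mul hc, ← f3] at f4
  exact Nat.le_of_mul_le_mul_left f4 (Nat.totient_pos.2 hN)

instance auxIntegral : Algebra.IsIntegral ℚ (AlgebraicClosure ℚ) := by
  have h : @Algebra.IsIntegral ℚ (AlgebraicClosure ℚ) _ _ (AlgebraicClosure.instAlgebra ℚ) :=
    @Algebra.IsAlgebraic.isIntegral _ _ _ _ (AlgebraicClosure.instAlgebra ℚ) (AlgebraicClosure.isAlgebraic ℚ)
  convert h
  exact Subsingleton.elim _ _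

theorem aux_primroot (n : ℕ) (hn : 0 < n) :
    ∃ ζ : AlgebraicClosure ℚ, IsPrimitiveRoot ζ n := by
  have : NeZero n := ⟨hn.ne'⟩
  exact HasEnoughRootsOfUnity.exists_primitiveRoot _ n

open Polynomial IntermediateField in
/-- Every element of `Zcop p` lies in a cyclotomic field of level prime to `p`. -/
theorem aux_mem_cyc (p : ℕ) {x : AlgebraicClosure ℚ} (hx : x ∈ Zcop p) :
    ∃ N : ℕ, 0 < N ∧ N.Coprime p ∧
      ∀ N', N ∣ N' → 0 < N' → ∀ η : AlgebraicClosure ℚ, IsPrimitiveRoot η N' → x ∈ ℚ⟮η⟯ := by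
  induction hx using Subring.closure_induction with
  | mem x hx =>
    obtain ⟨n, hn, hc, h1⟩ := hx
    refine ⟨n, hn, hc, ?_⟩
    rintro N' ⟨k, rfl⟩ hN' η hη
    have : NeZero (n * k) := ⟨hN'.ne'⟩
    obtain ⟨i, -, rfl⟩ := hη.eq_pow_of_pow_eq_one (ξ := x) (by rw [pow_mul, h1, one_pow])
    exact pow_mem (mem_adjoin_simple_self ℚ η) i
  | zero => exact ⟨1, one_pos, by simp, fun _ _ _ _ _ => zero_mem _⟩
  | one => exact ⟨1, one_pos, by simp, fun _ _ _ _ _ => one_mem _⟩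
  | add x y _ _ hx hy =>
    obtain ⟨a, ha, hac, ha'⟩ := hx
    obtain ⟨b, hb, hbc, hb'⟩ := hy
    exact ⟨a * b, Nat.mul_pos ha hb, hac.mul_left hbc, fun N' hd h0 η hη =>
      add_mem (ha' N' ((dvd_mul_right _ _).trans hd) h0 η hη)
        (hb' N' ((dvd_mul_left _ _).trans hd) h0 η hη)⟩
  | mul x y _ _ hx hy =>
    obtain ⟨a, ha, hac, ha'⟩ := hx
    obtain ⟨b, hb, hbc, hb'⟩ := hy
    exact ⟨a * b, Nat.mul_pos ha hb, hac.mul_left hbc, fun N' hd h0 η hη =>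
      mul_mem (ha' N' ((dvd_mul_right _ _).trans hd) h0 η hη)
        (hb' N' ((dvd_mul_left _ _).trans hd) h0 η hη)⟩
  | neg x _ hx =>
    obtain ⟨a, ha, hac, ha'⟩ := hx
    exact ⟨a, ha, hac, fun N' hd h0 η hη => neg_mem (ha' N' hd h0 η hη)⟩

open Polynomial IntermediateField in
theorem aux_poly_cyc (p : ℕ) (r : (Zcop p)[X]) :
    ∃ N : ℕ, 0 < N ∧ N.Coprime p ∧ ∀ η : AlgebraicClosure ℚ, IsPrimitiveRoot η N →
      ∀ i, ((r.coeff i : Zcop p) : AlgebraicClosure ℚ) ∈ ℚ⟮η⟯ := by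
  choose N hN hc h using fun i => aux_mem_cyc p (r.coeff i).2
  have hpos : 0 < ∏ i ∈ r.support, N i := Finset.prod_pos fun i _ => hN i
  refine ⟨∏ i ∈ r.support, N i, hpos,
    Nat.Coprime.prod_left fun i _ => hc i, fun η hη i => ?_⟩
  by_cases hi : i ∈ r.support
  · exact h i _ (Finset.dvd_prod_of_mem N hi) hpos η hη
  · rw [notMem_support_iff.1 hi]
    exact zero_mem _

open Polynomial IntermediateField in
theorem aux_zero (p M : ℕ) (hM : 0 < M) (hMp : ∀ N : ℕ, N.Coprime p → N.Coprime M)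
    {ζ : AlgebraicClosure ℚ} (hζ : IsPrimitiveRoot ζ M) (r : (Zcop p)[X])
    (hr : eval₂ (Zcop p).subtype ζ r = 0) (hd : r.degree < M.totient) : r = 0 := by
  obtain ⟨N, hN, hc, h⟩ := aux_poly_cyc p r
  obtain ⟨η, hη⟩ := aux_primroot N hN
  specialize h η hη
  have hdeg := aux_degree (fun n hn => cyclotomic.irreducible_rat hn) hN hM (hMp N hc) hη hζ
  have hinj : Function.Injective (Zcop p).subtype := Subtype.val_injective
  have hmem : r.map (Zcop p).subtype ∈ Polynomial.lifts (algebraMap ℚ⟮η⟯ (AlgebraicClosure ℚ)) := by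
    rw [lifts_iff_coeff_lifts]
    intro i
    rw [coeff_map]
    exact ⟨⟨_, h i⟩, rfl⟩
  obtain ⟨q, hq⟩ := (mem_lifts _).1 hmem
  have hq0 : aeval ζ q = 0 := by
    rw [← eval_map_algebraMap, hq, eval_map, hr]
  have hqd : q.degree = r.degree := by
    rw [← degree_map q (algebraMap ℚ⟮η⟯ (AlgebraicClosure ℚ)), hq, degree_map_eq_of_injective hinj]
  have : q = 0 := by
    by_contra hne
    have h2 := minpoly.degree_le_of_ne_zero ℚ⟮η⟯ ζ hne hq0
    have iζ : IsIntegral ℚ⟮η⟯ ζ := (Algebra.IsIntegral.isIntegral (R := ℚ) ζ).tower_top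
    rw [degree_eq_natDegree (minpoly.ne_zero iζ), hqd] at h2
    have h3 := h2.trans_lt hd
    have h4 : (minpoly ℚ⟮η⟯ ζ).natDegree < M.totient := by exact_mod_cast h3
    omega
  rw [this, degree_zero] at hqd
  exact degree_eq_bot.1 hqd.symm

open Polynomial in
/-- The kernel of evaluation at `ζ` over `Zcop p` is generated by the cyclotomic polynomial. -/
theorem aux_dvd (p : ℕ) (hp : p.Prime) (m : ℕ)
    {ζ : AlgebraicClosure ℚ} (hζ : IsPrimitiveRoot ζ (p ^ (m + 1))) (G : (Zcop p)[X])
    (hG : eval₂ (Zcop p).subtype ζ G = 0) : cyclotomic (p ^ (m + 1)) (Zcop p) ∣ G := by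
  have hpos : 0 < p ^ (m + 1) := pow_pos hp.pos _
  have hmon := cyclotomic.monic (p ^ (m + 1)) (Zcop p)
  rw [← modByMonic_eq_zero_iff_dvd hmon]
  refine aux_zero p (p ^ (m + 1)) hpos (fun N hN => Nat.Coprime.pow_right _ hN) hζ _ ?_ ?_
  · have h := congrArg (eval₂ (Zcop p).subtype ζ)
      (modByMonic_add_div G (cyclotomic (p ^ (m + 1)) (Zcop p)))
    rw [eval₂_add, eval₂_mul, hG, ← eval_map (p := cyclotomic _ _), map_cyclotomic,
      (hζ.isRoot_cyclotomic hpos).eq_zero, zero_mul, add_zero] at h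
    exact h
  · rw [← degree_cyclotomic (p ^ (m + 1)) (Zcop p)]
    exact degree_modByMonic_lt _ hmon

open Polynomial in
theorem aux_cyc_int (p : ℕ) (hp : p.Prime) (n : ℕ) :
    ∃ h : ℤ[X], cyclotomic (p ^ (n + 1)) ℤ = (X - 1) ^ (p ^ n * (p - 1)) + C (p : ℤ) * h := by
  have : Fact p.Prime := ⟨hp⟩
  have h := cyclotomic_mul_prime_pow_eq (ZMod p) (p := p) (m := 1) (k := n + 1)
    (by simpa using hp.one_lt.ne') (Nat.succ_pos _)
  have he : p ^ (n + 1) - p ^ (n + 1 - 1) = p ^ n * (p - 1) := by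
    rw [Nat.add_sub_cancel, pow_succ, Nat.mul_sub, mul_one]
  rw [mul_one, cyclotomic_one, he] at h
  have : C (p : ℤ) ∣ cyclotomic (p ^ (n + 1)) ℤ - (X - 1) ^ (p ^ n * (p - 1)) := by
    rw [C_dvd_iff_dvd_coeff]
    intro i
    rw [← ZMod.intCast_zmod_eq_zero_iff_dvd, ← eq_intCast (Int.castRingHom (ZMod p)), ← coeff_map]
    simp [h]
  obtain ⟨g, hg⟩ := this
  exact ⟨g, by rw [← hg]; ring⟩

open Polynomial in
/-- In a ring where `p = 0`, the cyclotomic polynomial is a power of `X - 1`. -/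
theorem aux_cyc_char (p : ℕ) (hp : p.Prime) (n : ℕ) (R : Type*) [CommRing R] (h0 : (p : R) = 0) :
    cyclotomic (p ^ (n + 1)) R = (X - 1) ^ (p ^ n * (p - 1)) := by
  obtain ⟨h, hh⟩ := aux_cyc_int p hp n
  have hcast : (p : R[X]) = 0 := by rw [← map_natCast (C : R →+* R[X]), h0, C_0]
  rw [← map_cyclotomic_int, hh]
  simp [hcast]

/-- A compatible system of `p`-power roots of unity. -/
theorem aux_system (p : ℕ) (hp : p.Prime) : ∃ ζ : ℕ → AlgebraicClosure ℚ,
    (∀ n, IsPrimitiveRoot (ζ n) (p ^ (n + 1))) ∧ ∀ n k, ζ (n + k) ^ p ^ k = ζ n := by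
  obtain ⟨z, hz⟩ := aux_primroot p hp.pos
  choose f hf using fun x : AlgebraicClosure ℚ => IsAlgClosed.exists_pow_nat_eq x hp.pos
  let ζ : ℕ → AlgebraicClosure ℚ := fun n => Nat.rec z (fun _ x => f x) n
  have hs : ∀ n, ζ (n + 1) ^ p = ζ n := fun n => hf (ζ n)
  have hk : ∀ n k, ζ (n + k) ^ p ^ k = ζ n := by
    intro n k
    induction k with
    | zero => simp
    | succ k ih => rw [pow_succ', pow_mul, ← add_assoc, hs, ih]
  refine ⟨ζ, fun n => ?_, hk⟩
  have : Fact p.Prime := ⟨hp⟩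
  have h0 : ζ n ^ p ^ n = z := by
    have h := hk 0 n
    rw [zero_add] at h
    exact h
  rw [IsPrimitiveRoot.iff_orderOf]
  apply orderOf_eq_prime_pow
  · rw [h0]; exact hz.ne_one hp.one_lt
  · rw [pow_succ, pow_mul, h0, hz.pow_eq_one]

theorem aux_split (p : ℕ) (hp : p.Prime) (x : AlgebraicClosure ℚ) (n : ℕ) (hn : 0 < n)
    (h1 : x ^ n = 1) : ∃ (k q : ℕ) (a b : AlgebraicClosure ℚ), 0 < q ∧ q.Coprime p ∧
      a ^ p ^ k = 1 ∧ b ^ q = 1 ∧ x = a * b := by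
  obtain ⟨k, q, hq, rfl⟩ := Nat.exists_eq_pow_mul_and_not_dvd hn.ne' p hp.ne_one
  have hqc : q.Coprime p := ((Nat.Prime.coprime_iff_not_dvd hp).2 hq).symm
  have hx0 : x ≠ 0 := by
    rintro rfl
    rw [zero_pow hn.ne'] at h1
    exact zero_ne_one h1
  have hbez := Nat.gcd_eq_gcd_ab (p ^ k) q
  rw [(Nat.Coprime.pow_left k hqc.symm).gcd_eq_one] at hbez
  set u := Nat.gcdA (p ^ k) q
  set v := Nat.gcdB (p ^ k) q
  have h1z : x ^ ((p ^ k : ℕ) * q : ℤ) = 1 := by exact_mod_cast h1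
  refine ⟨k, q, x ^ ((q : ℤ) * v), x ^ (((p ^ k : ℕ) : ℤ) * u), ?_, hqc, ?_, ?_, ?_⟩
  · exact Nat.pos_of_ne_zero (by rintro rfl; simp at hq)
  · rw [← zpow_natCast, ← zpow_mul,
      show (q : ℤ) * v * (p ^ k : ℕ) = (((p ^ k : ℕ) : ℤ) * q) * v by ring, zpow_mul, h1z, one_zpow]
  · rw [← zpow_natCast, ← zpow_mul,
      show ((p ^ k : ℕ) : ℤ) * u * q = (((p ^ k : ℕ) : ℤ) * q) * u by ring, zpow_mul, h1z, one_zpow]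
  · rw [← zpow_add₀ hx0, add_comm, ← hbez]
    simp

open Polynomial in
theorem aux_gen (p : ℕ) (hp : p.Prime) (ζ : ℕ → AlgebraicClosure ℚ)
    (hζ : ∀ n, IsPrimitiveRoot (ζ n) (p ^ (n + 1))) {x : AlgebraicClosure ℚ} (hx : x ∈ Zab) :
    ∃ N, ∀ m, N ≤ m → ∃ h : (Zcop p)[X], eval₂ (Zcop p).subtype (ζ m) h = x := by
  induction hx using Subring.closure_induction with
  | mem x hx =>
    obtain ⟨n, hn, h1⟩ := hx
    obtain ⟨k, q, a, b, hq, hqc, ha, hb, rfl⟩ := aux_split p hp x n hn h1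
    refine ⟨k, fun m hm => ?_⟩
    have : NeZero (p ^ (m + 1)) := ⟨(pow_pos hp.pos _).ne'⟩
    obtain ⟨i, -, hi⟩ := (hζ m).eq_pow_of_pow_eq_one (ξ := a) (by
      obtain ⟨c, hc⟩ := pow_dvd_pow p (show k ≤ m + 1 by omega)
      rw [hc, pow_mul, ha, one_pow])
    refine ⟨X ^ i * C ⟨b, Subring.subset_closure ⟨q, hq, hqc, hb⟩⟩, ?_⟩
    rw [eval₂_mul, eval₂_X_pow, eval₂_C, hi]
    rfl
  | zero => exact ⟨0, fun m _ => ⟨0, by simp⟩⟩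
  | one => exact ⟨0, fun m _ => ⟨1, by simp⟩⟩
  | add x y _ _ hx hy =>
    obtain ⟨a, ha⟩ := hx
    obtain ⟨b, hb⟩ := hy
    refine ⟨max a b, fun m hm => ?_⟩
    obtain ⟨f, hf⟩ := ha m ((le_max_left _ _).trans hm)
    obtain ⟨g, hg⟩ := hb m ((le_max_right _ _).trans hm)
    exact ⟨f + g, by rw [eval₂_add, hf, hg]⟩
  | mul x y _ _ hx hy =>
    obtain ⟨a, ha⟩ := hx
    obtain ⟨b, hb⟩ := hy
    refine ⟨max a b, fun m hm => ?_⟩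
    obtain ⟨f, hf⟩ := ha m ((le_max_left _ _).trans hm)
    obtain ⟨g, hg⟩ := hb m ((le_max_right _ _).trans hm)
    exact ⟨f * g, by rw [eval₂_mul, hf, hg]⟩
  | neg x _ hx =>
    obtain ⟨a, ha⟩ := hx
    refine ⟨a, fun m hm => ?_⟩
    obtain ⟨f, hf⟩ := ha m hm
    exact ⟨-f, by rw [eval₂_neg, hf]⟩

theorem aux_le (p : ℕ) : Zcop p ≤ Zab :=
  Subring.closure_mono fun _ ⟨n, hn, _, h⟩ => ⟨n, hn, h⟩

/-- The map `R_p → ℤ^ab/p`. -/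
noncomputable def auxRho (p : ℕ) : Rp p →+* ZabMod p :=
  Ideal.Quotient.lift _ ((Ideal.Quotient.mk _).comp (Subring.inclusion (aux_le p)))
    (fun a ha => by
      rw [Ideal.mem_span_singleton] at ha
      obtain ⟨b, rfl⟩ := ha
      rw [RingHom.comp_apply, Ideal.Quotient.eq_zero_iff_mem, map_mul, map_natCast]
      exact Ideal.mul_mem_right _ _ (Ideal.mem_span_singleton_self _))

theorem auxRho_mk (p : ℕ) (a : Zcop p) : auxRho p (Ideal.Quotient.mk _ a) =
    Ideal.Quotient.mk _ (Subring.inclusion (aux_le p) a) := rfl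

theorem aux_p_zero (p : ℕ) : (p : ZabMod p) = 0 := by
  rw [← map_natCast (Ideal.Quotient.mk _), Ideal.Quotient.eq_zero_iff_mem]
  exact Ideal.mem_span_singleton_self _

theorem aux_p_zero_rp (p : ℕ) : (p : Rp p) = 0 := by
  rw [← map_natCast (Ideal.Quotient.mk _), Ideal.Quotient.eq_zero_iff_mem]
  exact Ideal.mem_span_singleton_self _

theorem aux_frob (p : ℕ) (hp : p.Prime) (R : Type*) [CommRing R] (h0 : (p : R) = 0) (k : ℕ)
    (x : R) : (x + 1) ^ p ^ k = x ^ p ^ k + 1 := by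
  obtain ⟨r, hr⟩ := exists_add_pow_prime_pow_eq hp x 1 k
  rw [hr, h0]; simp

open Polynomial in
/-- The stage maps `R_p[X]/(X^{p^n(p-1)}) → ℤ^ab/p`, sending `X` to `ζ - 1`. -/
noncomputable def auxStage {R S : Type*} [CommRing R] [CommRing S] (ρ : R →+* S) (a : ℕ) (z : S)
    (h : z ^ a = 0) : (R[X] ⧸ Ideal.span {(X : R[X]) ^ a}) →+* S :=
  Ideal.Quotient.lift _ (eval₂RingHom ρ z) (fun f hf => by
    rw [Ideal.mem_span_singleton] at hf
    obtain ⟨g, rfl⟩ := hf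
    simp [eval₂_mul, eval₂_pow, h])

open Polynomial in
theorem auxStage_mk {R S : Type*} [CommRing R] [CommRing S] (ρ : R →+* S) (a : ℕ) (z : S)
    (h : z ^ a = 0) (f : R[X]) :
    auxStage ρ a z h (Ideal.Quotient.mk _ f) = eval₂ ρ z f := rfl

open Polynomial in
theorem aux_shift (p : ℕ) (hp : p.Prime) (R : Type*) [CommRing R] (h0 : (p : R) = 0) (N a : ℕ)
    (g Q : R[X]) (h : g.comp (X ^ p ^ N - 1) = (X - 1) ^ a * Q) :
    X ^ a ∣ eval₂ C (X ^ p ^ N) g := by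
  have hcast : (p : R[X]) = 0 := by rw [← map_natCast (C : R →+* R[X]), h0, C_0]
  have hQ2 := congrArg (fun q => q.comp (X + 1)) h
  simp only [mul_comp, comp_assoc, pow_comp, sub_comp, X_comp, one_comp, add_sub_cancel_right,
    aux_frob p hp _ hcast] at hQ2
  exact ⟨_, hQ2⟩

open Polynomial in
theorem aux_eval_subring {L : Type*} [CommRing L] (S T : Subring L) (h : S ≤ T) (z : T)
    (G : S[X]) : ((eval₂ (Subring.inclusion h) z G : T) : L) = eval₂ S.subtype (z : L) G := by
  change T.subtype _ = _
  rw [hom_eval₂]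
  rfl

open Polynomial in
theorem powQuotMap_mk (R : Type*) [CommRing R] (a b k : ℕ) (h : b ≤ a * k) (f : R[X]) :
    powQuotMap R a b k h (Ideal.Quotient.mk _ f) =
      Ideal.Quotient.mk _ (eval₂ C (X ^ k) f) := rfl

open Polynomial in
theorem aux_eval_mk (p : ℕ) (z : Zab) (G : (Zcop p)[X]) :
    eval₂ (auxRho p) (Ideal.Quotient.mk _ z) (G.map (Ideal.Quotient.mk _)) =
      Ideal.Quotient.mk _ (eval₂ (Subring.inclusion (aux_le p)) z G) := by
  rw [eval₂_map, hom_eval₂]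
  rfl

open Polynomial in
theorem aux_eval_val (p : ℕ) (z : Zab) (G : (Zcop p)[X]) :
    ((eval₂ (Subring.inclusion (aux_le p)) z G : Zab) : AlgebraicClosure ℚ) =
      eval₂ (Zcop p).subtype (z : AlgebraicClosure ℚ) G := by
  exact aux_eval_subring _ _ _ _ _

open Polynomial in
/-- Injectivity, at finite level. -/
theorem aux_inj (p : ℕ) (hp : p.Prime) (ζ : ℕ → AlgebraicClosure ℚ)
    (hζ : ∀ n, IsPrimitiveRoot (ζ n) (p ^ (n + 1))) (hk : ∀ n k, ζ (n + k) ^ p ^ k = ζ n)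
    (n : ℕ) (z : Zab) (hz : (z : AlgebraicClosure ℚ) = ζ n) (f : (Rp p)[X])
    (hf : eval₂ (auxRho p) (Ideal.Quotient.mk _ z - 1) f = 0) :
    ∃ k, X ^ (p ^ (n + k) * (p - 1)) ∣ eval₂ C (X ^ p ^ k) f := by
  obtain ⟨g, rfl⟩ := map_surjective _ Ideal.Quotient.mk_surjective f
  rw [← map_one (Ideal.Quotient.mk _), ← map_sub, aux_eval_mk, Ideal.Quotient.eq_zero_iff_mem,
    Ideal.mem_span_singleton] at hf
  obtain ⟨w, hw⟩ := hf
  have hwval := congrArg (Subtype.val) hw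
  rw [aux_eval_val] at hwval
  push_cast at hwval
  rw [hz] at hwval
  obtain ⟨N, hN⟩ := aux_gen p hp ζ hζ w.2
  obtain ⟨h, hh⟩ := hN (n + N) (Nat.le_add_left _ _)
  refine ⟨N, ?_⟩
  have hd := aux_dvd p hp (n + N) (hζ (n + N)) (g.comp (X ^ p ^ N - 1) - C (p : Zcop p) * h) (by
    rw [eval₂_sub, eval₂_mul, eval₂_comp, hh]
    simp [hk, hwval])
  obtain ⟨Q, hQ⟩ := hd
  have hQmod := congrArg (Polynomial.map (Ideal.Quotient.mk (Ideal.span {(p : Zcop p)}))) hQ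
  rw [Polynomial.map_mul, map_cyclotomic, aux_cyc_char p hp _ (Rp p) (aux_p_zero_rp p),
    Polynomial.map_sub, Polynomial.map_mul, map_C, map_natCast, aux_p_zero_rp p, C_0, zero_mul,
    sub_zero, Polynomial.map_comp] at hQmod
  rw [Polynomial.map_sub, Polynomial.map_pow, map_X, Polynomial.map_one] at hQmod
  exact aux_shift p hp (Rp p) (aux_p_zero_rp p) _ _ _ _ hQmod

/-- Fix a prime `p`. There is a ring isomorphism
`ℤ^ab/pℤ^ab ≅ R_p[t^{1/p^∞}]/(t^{p-1})`. -/
theorem stmt5 (p : ℕ) (hp : p.Prime) :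
    Nonempty (ZabMod p ≃+* PerfQuot (Rp p) p) := by
  obtain ⟨ζ, hζ, hk⟩ := aux_system p hp
  let z : ℕ → Zab := fun n => ⟨ζ n, Subring.subset_closure
    ⟨p ^ (n + 1), pow_pos hp.pos _, (hζ n).pow_eq_one⟩⟩
  have hzk : ∀ n k, z (n + k) ^ p ^ k = z n := fun n k => Subtype.ext (hk n k)
  let y : ℕ → ZabMod p := fun n => Ideal.Quotient.mk _ (z n) - 1
  have hy : ∀ n, y n ^ (p ^ n * (p - 1)) = 0 := by
    intro n
    have h1 : (Polynomial.cyclotomic (p ^ (n + 1)) Zab).eval (z n) = 0 := by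
      have hz : IsPrimitiveRoot (z n) (p ^ (n + 1)) :=
        IsPrimitiveRoot.of_map_of_injective (f := Zab.subtype) (hζ n) Subtype.val_injective
      exact hz.isRoot_cyclotomic (pow_pos hp.pos _)
    have h2 := congrArg (Ideal.Quotient.mk (Ideal.span {(p : Zab)})) h1
    rw [← Polynomial.eval₂_at_apply, ← Polynomial.eval_map, Polynomial.map_cyclotomic,
      aux_cyc_char p hp n (ZabMod p) (aux_p_zero p)] at h2
    simpa using h2
  have hyk : ∀ n k, y (n + k) ^ p ^ k = y n := by
    intro n k
    have h := aux_frob p hp (ZabMod p) (aux_p_zero p) k (y (n + k))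
    simp only [y, sub_add_cancel, ← map_pow, hzk] at h ⊢
    rw [h]; simp
  let F : PerfQuot (Rp p) p →+* ZabMod p := Ring.DirectLimit.lift _ _ _
    (fun n => auxStage (auxRho p) (p ^ n * (p - 1)) (y n) (hy n)) (by
      intro n m hnm x
      obtain ⟨f, rfl⟩ := Ideal.Quotient.mk_surjective x
      obtain ⟨k, rfl⟩ := Nat.exists_eq_add_of_le hnm
      rw [powQuotMap_mk, auxStage_mk, auxStage_mk]
      change Polynomial.eval₂ _ _ (f.comp _) = _
      rw [Polynomial.eval₂_comp, Nat.add_sub_cancel_left]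
      simp [hyk])
  refine ⟨(RingEquiv.ofBijective F ⟨?_, ?_⟩).symm⟩
  · rw [injective_iff_map_eq_zero]
    intro x hx
    obtain ⟨n, x, rfl⟩ := Ring.DirectLimit.exists_of x
    obtain ⟨f, rfl⟩ := Ideal.Quotient.mk_surjective x
    simp only [F, Ring.DirectLimit.lift_of, auxStage_mk] at hx
    obtain ⟨k, hd⟩ := aux_inj p hp ζ hζ hk n (z n) rfl f hx
    rw [← Ring.DirectLimit.of_f (Nat.le_add_right n k), powQuotMap_mk]
    rw [← map_zero (Ring.DirectLimit.of _ _ (n + k))]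
    congr 1
    rw [Ideal.Quotient.eq_zero_iff_mem, Ideal.mem_span_singleton, Nat.add_sub_cancel_left]
    exact hd
  · intro w
    obtain ⟨w, rfl⟩ := Ideal.Quotient.mk_surjective w
    obtain ⟨N, hN⟩ := aux_gen p hp ζ hζ w.2
    obtain ⟨h, hh⟩ := hN N le_rfl
    refine ⟨Ring.DirectLimit.of _ _ N (Ideal.Quotient.mk _
      ((h.comp (Polynomial.X + 1)).map (Ideal.Quotient.mk _))), ?_⟩
    simp only [F, Ring.DirectLimit.lift_of, auxStage_mk, y]
    rw [← map_one (Ideal.Quotient.mk _), ← map_sub, aux_eval_mk]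
    congr 1
    apply Subtype.ext
    rw [aux_eval_val, ← hh, Polynomial.eval₂_comp]
    simp [z]

end
end
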